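/- Let k₁ = 0 and k₂ > 0, and define s₀(t) = 2·sinh²(√(k₂/2)·t) − √(2k₂)·t·cosh(√(k₂/2)·t)·sinh(√(k₂/2)·t), s₁(t) = −2√(2k₂³)·sinh(√(k₂/2)·t)·cosh(√(k₂/2)·t), s₂(t) = −2k₂·sinh²(√(k₂/2)·t). Assume ∇²h ≥ [[0, 0],[0, −k₂ I]] (in n×n block form) everywhere. Then for every t ∈ (0,T) and every (x,v) ∈ ℝⁿ×ℝⁿ, the 2n×2n symmetric matrix inequality ∇² log ρ(t,x,v) − ½∇²U(x,v) ≥ ½·[[−(s₁(t)/s₀(t)) I, (s₂(t)/s₀(t)) I],[(s₂(t)/s₀(t)) I, −(s₀'(t)/s₀(t)) I]] holds. -/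

import Mathlib

noncomputable section
open Real Set Matrix

/-- `ℝⁿ` with the Euclidean norm. -/
abbrev E (n : ℕ) := EuclideanSpace ℝ (Fin n)

/-- The standard basis of `ℝⁿ × ℝⁿ`, indexed by `Fin n ⊕ Fin n`: `Sum.inl i` is the `i`-th
`x`-direction and `Sum.inr i` is the `i`-th `v`-direction. -/
def stdBasis (n : ℕ) : Fin n ⊕ Fin n → E n × E n
  | Sum.inl i => (EuclideanSpace.single i 1, 0)
  | Sum.inr i => (0, EuclideanSpace.single i 1)

/-- Partial derivative of `φ : ℝⁿ × ℝⁿ → ℝ` in the `j`-th coordinate direction. -/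
def pd {n : ℕ} (φ : E n × E n → ℝ) (j : Fin n ⊕ Fin n) (p : E n × E n) : ℝ :=
  fderiv ℝ φ p (stdBasis n j)

/-- The full Hessian of `φ` in the variables `(x, v)`, as a `2n × 2n` matrix. -/
def Hess {n : ℕ} (φ : E n × E n → ℝ) (p : E n × E n) :
    Matrix (Fin n ⊕ Fin n) (Fin n ⊕ Fin n) ℝ :=
  Matrix.of fun i j => pd (pd φ j) i p

/-- The Laplacian in the `v`-variables: `Δ_v φ = Σᵢ ∂²φ/∂vᵢ²`. -/
def lapV {n : ℕ} (φ : E n × E n → ℝ) (p : E n × E n) : ℝ :=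
  ∑ i : Fin n, pd (pd φ (Sum.inr i)) (Sum.inr i) p

/-- The squared Euclidean norm of the full gradient `∇φ`. -/
def gradNormSq {n : ℕ} (φ : E n × E n → ℝ) (p : E n × E n) : ℝ :=
  ∑ j : Fin n ⊕ Fin n, (pd φ j p) ^ 2

/-- The function `h = -½⟨v, ∇ₓU⟩ + ½Δ_v U - ¼|∇_v U|²`. -/
def hfun {n : ℕ} (U : E n × E n → ℝ) (p : E n × E n) : ℝ :=
  -(1/2) * (∑ i : Fin n, p.2 i * pd U (Sum.inl i) p) + (1/2) * lapV U p
    - (1/4) * ∑ i : Fin n, (pd U (Sum.inr i) p) ^ 2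

/-- The block-diagonal matrix `[[a·I, 0], [0, b·I]]`. -/
def blockDiag (n : ℕ) (a b : ℝ) : Matrix (Fin n ⊕ Fin n) (Fin n ⊕ Fin n) ℝ :=
  Matrix.fromBlocks (a • 1) 0 0 (b • 1)

/-- The right-hand side `½·[[-(s₁/s₀)I, (s₂/s₀)I], [(s₂/s₀)I, -(s₀'/s₀)I]]` of the
matrix differential Harnack inequality. -/
def harnackMatrix (n : ℕ) (s₀ s₁ s₂ : ℝ → ℝ) (t : ℝ) :
    Matrix (Fin n ⊕ Fin n) (Fin n ⊕ Fin n) ℝ :=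
  (1/2 : ℝ) • Matrix.fromBlocks (-(s₁ t / s₀ t) • 1) ((s₂ t / s₀ t) • 1)
    ((s₂ t / s₀ t) • 1) (-(deriv s₀ t / s₀ t) • 1)

/-- `s₀` in the case `k₂² > 2k₁ = 0`. -/
def s0D (k₂ t : ℝ) : ℝ :=
  2 * Real.sinh (Real.sqrt (k₂ / 2) * t) ^ 2
    - Real.sqrt (2 * k₂) * t * Real.cosh (Real.sqrt (k₂ / 2) * t) *
        Real.sinh (Real.sqrt (k₂ / 2) * t)

/-- `s₁` in the case `k₂² > 2k₁ = 0`. -/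
def s1D (k₂ t : ℝ) : ℝ :=
  -2 * Real.sqrt (2 * k₂ ^ 3) * Real.sinh (Real.sqrt (k₂ / 2) * t) *
    Real.cosh (Real.sqrt (k₂ / 2) * t)

/-- `s₂` in the case `k₂² > 2k₁ = 0`. -/
def s2D (k₂ t : ℝ) : ℝ := -2 * k₂ * Real.sinh (Real.sqrt (k₂ / 2) * t) ^ 2

section Calculus
open Filter Topology

/-- A function with a local minimum at `0` has nonnegative second derivative there. -/
theorem second_deriv_nonneg_of_isLocalMin {g g' : ℝ → ℝ} {c : ℝ} (hmin : IsLocalMin g 0)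
    (hg : ∀ᶠ s in 𝓝 0, HasDerivAt g (g' s) s) (hg' : HasDerivAt g' c 0) : 0 ≤ c := by
  by_contra! hc
  have hg0 : HasDerivAt g (g' 0) 0 := hg.self_of_nhds
  have hz : g' 0 = 0 := hmin.hasDerivAt_eq_zero hg0
  have hderiv : deriv g =ᶠ[𝓝 0] g' := hg.mono fun s hs => hs.deriv
  have hmax : IsLocalMin (-g) 0 := by
    refine isLocalMin_of_deriv_deriv_pos ?_ ?_ hg0.continuousAt.neg
    · have h1 : deriv (-g) =ᶠ[𝓝 0] -g' := hg.mono fun s hs => hs.neg.deriv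
      rw [h1.deriv_eq, hg'.neg.deriv]
      linarith
    · rw [hg0.neg.deriv, hz, neg_zero]
  have hconst : g =ᶠ[𝓝 0] fun _ => g 0 := by
    filter_upwards [hmin, hmax] with s h1 h2
    simp only [Pi.neg_apply, neg_le_neg_iff] at h2
    exact le_antisymm h2 h1
  have h3 : g' =ᶠ[𝓝 0] fun _ => 0 := by
    refine hderiv.symm.trans ?_
    filter_upwards [hconst.eventuallyEq_nhds] with s hs
    rw [hs.deriv_eq, deriv_const]
  have h4 : c = 0 := by
    rw [← hg'.deriv, h3.deriv_eq, deriv_const]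
  exact hc.ne h4

/-- A function that is nonnegative to the left of a zero has nonpositive derivative there. -/
theorem deriv_nonpos_of_nonneg_left {u : ℝ → ℝ} {a t d : ℝ} (hat : a < t)
    (hu : ∀ s ∈ Icc a t, 0 ≤ u s) (ht : u t = 0) (hd : HasDerivAt u d t) : d ≤ 0 := by
  have h1 := (hasDerivWithinAt_iff_tendsto_slope' (s := Iio t) (by simp)).1 hd.hasDerivWithinAt
  refine le_of_tendsto h1 ?_
  filter_upwards [Ioo_mem_nhdsLT hat] with s hs
  rw [slope_def_field, ht, sub_zero]
  exact div_nonpos_of_nonneg_of_nonpos (hu s ⟨hs.1.le, hs.2.le⟩) (by linarith [hs.2])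

/-- If a continuous family `m t` is positive at the initial time and its nonpositive set is
contained in a compact set, then either it stays positive, or it touches zero for a first time. -/
theorem exists_first_touch {X : Type*} [TopologicalSpace X] [T2Space X] {m : ℝ → X → ℝ} {a b : ℝ}
    {K : Set X} (hK : IsCompact K)
    (hc : ContinuousOn (fun q : ℝ × X => m q.1 q.2) (Icc a b ×ˢ univ))
    (hin : ∀ t ∈ Icc a b, ∀ x, m t x ≤ 0 → x ∈ K) (h0 : ∀ x, 0 < m a x)
    (hex : ∃ t ∈ Icc a b, ∃ x, m t x ≤ 0) :
    ∃ t ∈ Ioc a b, ∃ x, m t x = 0 ∧ ∀ s ∈ Icc a t, ∀ y, 0 ≤ m s y := by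
  have hcpt : IsCompact (Icc a b ×ˢ K) := isCompact_Icc.prod hK
  have hcl : IsClosed ((Icc a b ×ˢ K) ∩ (fun q : ℝ × X => m q.1 q.2) ⁻¹' Iic 0) :=
    (hc.mono (prod_mono le_rfl (subset_univ _))).preimage_isClosed_of_isClosed
      hcpt.isClosed isClosed_Iic
  have hS := hcpt.of_isClosed_subset hcl inter_subset_left
  obtain ⟨t₁, ht₁, x₁, hx₁⟩ := hex
  obtain ⟨⟨t, x⟩, ⟨⟨ht, -⟩, hm⟩, hmin⟩ := hS.exists_isMinOn
    ⟨(t₁, x₁), ⟨⟨ht₁, hin _ ht₁ _ hx₁⟩, hx₁⟩⟩ (continuous_fst.continuousOn)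
  have hpos : ∀ s ∈ Icc a b, s < t → ∀ y, 0 < m s y := by
    intro s hs hst y
    by_contra! hle
    exact absurd (hmin (show (s, y) ∈ _ from ⟨⟨hs, hin _ hs _ hle⟩, hle⟩)) (not_le.2 hst)
  have hat : a < t := by
    rcases ht.1.lt_or_eq with h | h
    · exact h
    · subst h; exact absurd hm (not_le.2 (h0 x))
  have hnn : ∀ y, 0 ≤ m t y := by
    intro y
    have h1 : ContinuousWithinAt (fun s => m s y) (Icc a b) t :=
      (hc (t, y) ⟨ht, mem_univ _⟩).comp (f := fun s : ℝ => (s, y)) (by fun_prop)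
        fun s hs => ⟨hs, mem_univ _⟩
    have h2 : Tendsto (fun s => m s y) (𝓝[<] t) (𝓝 (m t y)) := by
      refine Tendsto.mono_left h1 (nhdsWithin_le_iff.2 ?_)
      filter_upwards [Ioo_mem_nhdsLT hat] with s hs
      exact ⟨hs.1.le, hs.2.le.trans ht.2⟩
    refine ge_of_tendsto h2 ?_
    filter_upwards [Ioo_mem_nhdsLT hat] with s hs
    exact (hpos s ⟨hs.1.le, hs.2.le.trans ht.2⟩ hs.2 y).le
  refine ⟨t, ⟨hat, ht.2⟩, x, le_antisymm hm (hnn x), fun s hs y => ?_⟩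
  rcases hs.2.lt_or_eq with h | h
  · exact (hpos s ⟨hs.1, hs.2.trans ht.2⟩ h y).le
  · exact h ▸ hnn y

variable {V : Type*} [NormedAddCommGroup V] [NormedSpace ℝ V]

/-- Second derivative of `g` at `z` in the direction `ζ`. -/
def dirDeriv2 (g : V → ℝ) (ζ z : V) : ℝ := fderiv ℝ (fun y => fderiv ℝ g y ζ) z ζ

theorem hasDerivAt_line {g : V → ℝ} (hg : Differentiable ℝ g) (z ζ : V) (s : ℝ) :
    HasDerivAt (fun s : ℝ => g (z + s • ζ)) (fderiv ℝ g (z + s • ζ) ζ) s := by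
  have h1 : HasDerivAt (fun s : ℝ => z + s • ζ) ((1 : ℝ) • ζ) s :=
    ((hasDerivAt_id s).smul_const ζ).const_add z
  rw [one_smul] at h1
  exact (hg _).hasFDerivAt.comp_hasDerivAt s h1

theorem contDiff_fderiv_apply {g : V → ℝ} (hg : ContDiff ℝ (⊤ : ℕ∞) g) (ζ : V) :
    ContDiff ℝ (⊤ : ℕ∞) fun y => fderiv ℝ g y ζ :=
  (hg.fderiv_right (m := (⊤ : ℕ∞)) (by simp)).clm_apply contDiff_const

theorem differentiable_of_smooth {g : V → ℝ} (hg : ContDiff ℝ (⊤ : ℕ∞) g) :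
    Differentiable ℝ g := hg.differentiable (by simp)

theorem hasDerivAt_line2 {g : V → ℝ} (hg : ContDiff ℝ (⊤ : ℕ∞) g) (z ζ : V) (s : ℝ) :
    HasDerivAt (fun s : ℝ => fderiv ℝ g (z + s • ζ) ζ) (dirDeriv2 g ζ (z + s • ζ)) s :=
  hasDerivAt_line (differentiable_of_smooth (contDiff_fderiv_apply hg ζ)) z ζ s

/-- First order Taylor lower bound under a lower bound on the second directional derivative. -/
theorem taylor_lower_bound {g : V → ℝ} (hg : ContDiff ℝ (⊤ : ℕ∞) g) {z ζ : V} {c : ℝ}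
    (hc : ∀ s ∈ Icc (0 : ℝ) 1, -c ≤ dirDeriv2 g ζ (z + s • ζ)) :
    g z + fderiv ℝ g z ζ - c / 2 ≤ g (z + ζ) := by
  have hd : ∀ s : ℝ, HasDerivAt (fun s : ℝ => g (z + s • ζ) + c / 2 * s ^ 2)
      (fderiv ℝ g (z + s • ζ) ζ + c * s) s := by
    intro s
    refine ((hasDerivAt_line (differentiable_of_smooth hg) z ζ s).add
      ((hasDerivAt_pow 2 s).const_mul (c / 2))).congr_deriv ?_
    simp; ring
  have hd2 : ∀ s : ℝ, HasDerivAt (fun s : ℝ => fderiv ℝ g (z + s • ζ) ζ + c * s)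
      (dirDeriv2 g ζ (z + s • ζ) + c) s := by
    intro s
    refine ((hasDerivAt_line2 hg z ζ s).add ((hasDerivAt_id s).const_mul c)).congr_deriv ?_
    simp
  obtain ⟨ξ, hξ, h1⟩ := exists_hasDerivAt_eq_slope _ _ (zero_lt_one (α := ℝ))
    (fun s _ => (hd s).continuousAt.continuousWithinAt) (fun s _ => hd s)
  obtain ⟨η, hη, h2⟩ := exists_hasDerivAt_eq_slope _ _ hξ.1
    (fun s _ => (hd2 s).continuousAt.continuousWithinAt) (fun s _ => hd2 s)
  have h3 := hc η ⟨hη.1.le, hη.2.le.trans hξ.2.le⟩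
  simp only [zero_smul, add_zero, one_smul, mul_zero, sub_zero, div_one] at h1 h2
  rw [eq_div_iff hξ.1.ne'] at h2
  have h4 : 0 ≤ (dirDeriv2 g ζ (z + η • ζ) + c) * ξ := mul_nonneg (by linarith) hξ.1.le
  norm_num at h1
  linarith

end Calculus

section Coordinates
open Filter Topology

variable {n : ℕ}

/-- The coordinate vector of a point of `ℝⁿ × ℝⁿ`. -/
def coords (ζ : E n × E n) : Fin n ⊕ Fin n → ℝ := Sum.elim ζ.1 ζ.2

theorem sum_coords_smul_stdBasis (ζ : E n × E n) : ∑ j, coords ζ j • stdBasis n j = ζ := by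
  have h : ∀ x : E n, ∑ i, x i • EuclideanSpace.single i (1 : ℝ) = x := by
    intro x
    ext k
    simp [Finset.sum_apply, Pi.single_apply]
  rw [Fintype.sum_sum_type]
  refine Prod.ext ?_ ?_
  · simp only [coords, _root_.stdBasis, Sum.elim_inl, Sum.elim_inr, Prod.fst_add, Prod.fst_sum,
      Prod.smul_fst, smul_zero, Finset.sum_const_zero, add_zero, h]
  · simp only [coords, _root_.stdBasis, Sum.elim_inl, Sum.elim_inr, Prod.snd_add, Prod.snd_sum,
      Prod.smul_snd, smul_zero, Finset.sum_const_zero, zero_add, h]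

theorem sum_coords_sq (ζ : E n × E n) : ∑ j, coords ζ j ^ 2 = ‖ζ.1‖ ^ 2 + ‖ζ.2‖ ^ 2 := by
  simp [Fintype.sum_sum_type, coords, EuclideanSpace.real_norm_sq_eq]

theorem fderiv_eq_sum_pd (g : E n × E n → ℝ) (z ζ : E n × E n) :
    fderiv ℝ g z ζ = ∑ j, coords ζ j * pd g j z := by
  conv_lhs => rw [← sum_coords_smul_stdBasis ζ]
  simp [pd]

theorem contDiff_pd {g : E n × E n → ℝ} (hg : ContDiff ℝ (⊤ : ℕ∞) g) (j : Fin n ⊕ Fin n) :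
    ContDiff ℝ (⊤ : ℕ∞) (pd g j) := contDiff_fderiv_apply hg _

theorem coords_dotProduct_hess {g : E n × E n → ℝ} (hg : ContDiff ℝ (⊤ : ℕ∞) g)
    (z ζ : E n × E n) : coords ζ ⬝ᵥ (Hess g z *ᵥ coords ζ) = dirDeriv2 g ζ z := by
  have h1 : (fun y => fderiv ℝ g y ζ) = fun y => ∑ j, coords ζ j * pd g j y :=
    funext fun y => fderiv_eq_sum_pd g y ζ
  have hd : ∀ j, DifferentiableAt ℝ (pd g j) z := fun j =>
    differentiable_of_smooth (contDiff_pd hg j) z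
  rw [dirDeriv2, h1, fderiv_fun_sum fun j _ => (hd j).const_mul _]
  simp only [_root_.sum_apply, fderiv_const_mul (hd _), _root_.smul_apply,
    smul_eq_mul, fderiv_eq_sum_pd, dotProduct, mulVec, Hess, Matrix.of_apply, Finset.mul_sum]
  rw [Finset.sum_comm]
  refine Finset.sum_congr rfl fun j _ => Finset.sum_congr rfl fun i _ => ?_
  ring

theorem hess_isHermitian {g : E n × E n → ℝ} (hg : ContDiff ℝ (⊤ : ℕ∞) g) (z : E n × E n) :
    (Hess g z).IsHermitian := by
  have hsymm : IsSymmSndFDerivAt ℝ g z := by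
    refine hg.contDiffAt.isSymmSndFDerivAt ?_
    rw [minSmoothness_of_isRCLikeNormedField]
    exact WithTop.coe_le_coe.2 (le_top : (2 : ℕ∞) ≤ ⊤)
  have hdd : DifferentiableAt ℝ (fderiv ℝ g) z :=
    ((hg.fderiv_right (m := (⊤ : ℕ∞)) (by simp)).differentiable (by simp)) z
  have key : ∀ i j, pd (pd g j) i z = fderiv ℝ (fderiv ℝ g) z (stdBasis n i) (stdBasis n j) := by
    intro i j
    change fderiv ℝ (fun y => fderiv ℝ g y (stdBasis n j)) z (stdBasis n i) = _
    rw [fderiv_clm_apply hdd (differentiableAt_const _)]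
    simp
  refine Matrix.IsHermitian.ext fun i j => ?_
  simp only [Hess, Matrix.of_apply, star_trivial, key]
  exact hsymm _ _

theorem lapV_eq_sum (g : E n × E n → ℝ) (z : E n × E n) :
    lapV g z = ∑ i, dirDeriv2 g (stdBasis n (Sum.inr i)) z := rfl

theorem transport_eq_sum (g : E n × E n → ℝ) (z : E n × E n) (y : E n) :
    fderiv ℝ g z (y, 0) = ∑ i, y i * pd g (Sum.inl i) z := by
  rw [fderiv_eq_sum_pd]
  simp [Fintype.sum_sum_type, coords]

theorem dotProduct_one_mulVec (c : Fin n ⊕ Fin n → ℝ) (a : ℝ) :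
    c ⬝ᵥ ((a • (1 : Matrix (Fin n ⊕ Fin n) (Fin n ⊕ Fin n) ℝ)) *ᵥ c) = a * ∑ j, c j ^ 2 := by
  rw [Matrix.smul_mulVec, Matrix.one_mulVec, dotProduct_smul, smul_eq_mul, dotProduct]
  simp only [sq]

theorem coords_dotProduct_blocks (ζ : E n × E n) (a b d : ℝ) :
    coords ζ ⬝ᵥ (Matrix.fromBlocks (a • (1 : Matrix (Fin n) (Fin n) ℝ)) (b • 1) (b • 1) (d • 1)
      *ᵥ coords ζ) = a * ‖ζ.1‖ ^ 2 + 2 * b * inner ℝ ζ.1 ζ.2 + d * ‖ζ.2‖ ^ 2 := by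
  simp only [coords, Matrix.fromBlocks_mulVec, Sum.elim_comp_inl, Sum.elim_comp_inr,
    Matrix.smul_mulVec, Matrix.one_mulVec, EuclideanSpace.real_norm_sq_eq, PiLp.inner_apply,
    dotProduct, Fintype.sum_sum_type, Sum.elim_inl, Sum.elim_inr, Pi.add_apply, Pi.smul_apply,
    smul_eq_mul, RCLike.inner_apply, conj_trivial, Finset.mul_sum, ← Finset.sum_add_distrib]
  refine Finset.sum_congr rfl fun i _ => ?_
  ring

theorem dirDeriv2_le_of_posSemidef {g : E n × E n → ℝ} (hg : ContDiff ℝ (⊤ : ℕ∞) g)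
    {z : E n × E n} {a : ℝ}
    (h : (a • (1 : Matrix (Fin n ⊕ Fin n) (Fin n ⊕ Fin n) ℝ) - Hess g z).PosSemidef)
    (ζ : E n × E n) : dirDeriv2 g ζ z ≤ a * (‖ζ.1‖ ^ 2 + ‖ζ.2‖ ^ 2) := by
  have h1 := h.dotProduct_mulVec_nonneg (coords ζ)
  rw [star_trivial, Matrix.sub_mulVec, dotProduct_sub, dotProduct_one_mulVec,
    coords_dotProduct_hess hg, sum_coords_sq] at h1
  linarith

theorem le_dirDeriv2_of_posSemidef {g : E n × E n → ℝ} (hg : ContDiff ℝ (⊤ : ℕ∞) g)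
    {z : E n × E n} {k : ℝ} (h : (Hess g z - blockDiag n 0 (-k)).PosSemidef)
    (ζ : E n × E n) : -(k * ‖ζ.2‖ ^ 2) ≤ dirDeriv2 g ζ z := by
  have h1 := h.dotProduct_mulVec_nonneg (coords ζ)
  have h2 := coords_dotProduct_blocks ζ 0 0 (-k)
  rw [zero_smul] at h2
  rw [star_trivial, Matrix.sub_mulVec, dotProduct_sub, coords_dotProduct_hess hg, _root_.blockDiag,
    zero_smul, h2] at h1
  linarith

theorem abs_fderiv_le_gradNorm (g : E n × E n → ℝ) (z ζ : E n × E n) :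
    |fderiv ℝ g z ζ| ≤ Real.sqrt (gradNormSq g z) * Real.sqrt (‖ζ.1‖ ^ 2 + ‖ζ.2‖ ^ 2) := by
  rw [← sum_coords_sq, fderiv_eq_sum_pd, ←
    Real.sqrt_mul' _ (Finset.sum_nonneg fun i _ => sq_nonneg _)]
  refine Real.abs_le_sqrt ?_
  rw [gradNormSq, mul_comm]
  exact Finset.sum_mul_sq_le_sq_mul_sq _ _ _

theorem contDiff_lapV {g : E n × E n → ℝ} (hg : ContDiff ℝ (⊤ : ℕ∞) g) :
    ContDiff ℝ (⊤ : ℕ∞) (lapV g) :=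
  ContDiff.sum fun _ _ => contDiff_pd (contDiff_pd hg _) _

theorem contDiff_hfun {g : E n × E n → ℝ} (hg : ContDiff ℝ (⊤ : ℕ∞) g) :
    ContDiff ℝ (⊤ : ℕ∞) (hfun g) := by
  have h1 := contDiff_lapV hg
  have h2 := fun j => contDiff_pd hg j
  unfold hfun
  fun_prop

end Coordinates

section Riccati

/-- The coefficient of `|ξ|²` in the Harnack quadratic form. -/
def harnackXX (k t : ℝ) : ℝ := -(s1D k t / s0D k t) / 2

/-- Half of the coefficient of `⟨ξ, η⟩` in the Harnack quadratic form. -/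
def harnackXV (k t : ℝ) : ℝ := s2D k t / s0D k t / 2

/-- The coefficient of `|η|²` in the Harnack quadratic form. -/
def harnackVV (k t : ℝ) : ℝ := -(deriv (s0D k) t / s0D k t) / 2

theorem exists_eq_two_mul_sq {k : ℝ} (hk : 0 < k) : ∃ κ : ℝ, 0 < κ ∧ k = 2 * κ ^ 2 :=
  ⟨√(k / 2), Real.sqrt_pos.2 (by linarith), by rw [Real.sq_sqrt (by linarith)]; ring⟩

theorem sqrt_half_eq {κ : ℝ} (hκ : 0 < κ) : √(2 * κ ^ 2 / 2) = κ := by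
  rw [mul_div_cancel_left₀ _ two_ne_zero, Real.sqrt_sq hκ.le]

theorem s0D_eq {κ : ℝ} (hκ : 0 < κ) (t : ℝ) : s0D (2 * κ ^ 2) t =
    2 * sinh (κ * t) ^ 2 - 2 * κ * t * cosh (κ * t) * sinh (κ * t) := by
  have h : √(2 * (2 * κ ^ 2)) = 2 * κ := by
    rw [show 2 * (2 * κ ^ 2) = (2 * κ) ^ 2 by ring, Real.sqrt_sq (by positivity)]
  rw [s0D, sqrt_half_eq hκ, h]

theorem s1D_eq {κ : ℝ} (hκ : 0 < κ) (t : ℝ) : s1D (2 * κ ^ 2) t =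
    -(8 * κ ^ 3 * sinh (κ * t) * cosh (κ * t)) := by
  have h : √(2 * (2 * κ ^ 2) ^ 3) = 4 * κ ^ 3 := by
    rw [show 2 * (2 * κ ^ 2) ^ 3 = (4 * κ ^ 3) ^ 2 by ring, Real.sqrt_sq (by positivity)]
  rw [s1D, sqrt_half_eq hκ, h]
  ring

theorem s2D_eq {κ : ℝ} (hκ : 0 < κ) (t : ℝ) : s2D (2 * κ ^ 2) t =
    -(4 * κ ^ 2 * sinh (κ * t) ^ 2) := by
  rw [s2D, sqrt_half_eq hκ]
  ring

theorem hasDerivAt_sinh_mul (κ t : ℝ) :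
    HasDerivAt (fun t => sinh (κ * t)) (κ * cosh (κ * t)) t := by
  refine ((hasDerivAt_id t).const_mul κ).sinh.congr_deriv ?_
  simp only [id]
  ring

theorem hasDerivAt_cosh_mul (κ t : ℝ) :
    HasDerivAt (fun t => cosh (κ * t)) (κ * sinh (κ * t)) t := by
  refine ((hasDerivAt_id t).const_mul κ).cosh.congr_deriv ?_
  simp only [id]
  ring

theorem hasDerivAt_s0D {κ : ℝ} (hκ : 0 < κ) (t : ℝ) : HasDerivAt (s0D (2 * κ ^ 2))
    (2 * κ * sinh (κ * t) * cosh (κ * t)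
      - 2 * κ ^ 2 * t * (cosh (κ * t) ^ 2 + sinh (κ * t) ^ 2)) t := by
  rw [funext (s0D_eq hκ)]
  have hs := hasDerivAt_sinh_mul κ t
  have hc := hasDerivAt_cosh_mul κ t
  refine (((hs.pow 2).const_mul 2).sub
    ((((hasDerivAt_id t).const_mul (2 * κ)).mul hc).mul hs)).congr_deriv ?_
  simp only [id, Nat.cast_ofNat, Nat.reduceSub, pow_one, Pi.mul_apply]
  ring

theorem hasDerivAt_deriv_s0D {κ : ℝ} (hκ : 0 < κ) (t : ℝ) :
    HasDerivAt (deriv (s0D (2 * κ ^ 2))) (-(8 * κ ^ 3 * t * sinh (κ * t) * cosh (κ * t))) t := by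
  rw [funext fun t => (hasDerivAt_s0D hκ t).deriv]
  have hs := hasDerivAt_sinh_mul κ t
  have hc := hasDerivAt_cosh_mul κ t
  refine (((hs.const_mul (2 * κ)).mul hc).sub
    (((hasDerivAt_id t).const_mul (2 * κ ^ 2)).mul ((hc.pow 2).add (hs.pow 2)))).congr_deriv ?_
  simp only [id, Nat.cast_ofNat, Nat.reduceSub, pow_one, Pi.add_apply, Pi.pow_apply]
  ring

theorem hasDerivAt_s1D {κ : ℝ} (hκ : 0 < κ) (t : ℝ) : HasDerivAt (s1D (2 * κ ^ 2))
    (-(8 * κ ^ 4 * (cosh (κ * t) ^ 2 + sinh (κ * t) ^ 2))) t := by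
  rw [funext (s1D_eq hκ)]
  refine (((hasDerivAt_sinh_mul κ t).const_mul (8 * κ ^ 3)).mul
    (hasDerivAt_cosh_mul κ t)).neg.congr_deriv ?_
  ring

theorem hasDerivAt_s2D {κ : ℝ} (hκ : 0 < κ) (t : ℝ) : HasDerivAt (s2D (2 * κ ^ 2))
    (-(8 * κ ^ 3 * sinh (κ * t) * cosh (κ * t))) t := by
  rw [funext (s2D_eq hκ)]
  refine (((hasDerivAt_sinh_mul κ t).pow 2).const_mul (4 * κ ^ 2)).neg.congr_deriv ?_
  simp only [Nat.cast_ofNat, Nat.reduceSub, pow_one]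
  ring

theorem sinh_lt_mul_cosh {x : ℝ} (hx : 0 < x) : sinh x < x * cosh x := by
  have hd : ∀ y : ℝ, HasDerivAt (fun y => y * cosh y - sinh y) (y * sinh y) y := fun y => by
    refine (((hasDerivAt_id y).mul (hasDerivAt_cosh y)).sub (hasDerivAt_sinh y)).congr_deriv ?_
    simp
  have hm : StrictMonoOn (fun y => y * cosh y - sinh y) (Ici 0) := by
    refine strictMonoOn_of_deriv_pos (convex_Ici 0)
      (fun y _ => (hd y).continuousAt.continuousWithinAt) fun y hy => ?_
    rw [interior_Ici, mem_Ioi] at hy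
    rw [(hd y).deriv]
    exact mul_pos hy (sinh_pos_iff.2 hy)
  have h := hm self_mem_Ici hx.le hx
  simp only [zero_mul, sinh_zero, sub_zero] at h
  linarith

theorem s0D_neg {k t : ℝ} (hk : 0 < k) (ht : 0 < t) : s0D k t < 0 := by
  obtain ⟨κ, hκ, rfl⟩ := exists_eq_two_mul_sq hk
  have hx : 0 < κ * t := by positivity
  rw [s0D_eq hκ]
  have h1 := sinh_pos_iff.2 hx
  nlinarith [mul_pos h1 (sub_pos.2 (sinh_lt_mul_cosh hx))]

theorem wronskian_s0D_s1D {κ : ℝ} (hκ : 0 < κ) (t : ℝ) :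
    8 * κ ^ 4 * (cosh (κ * t) ^ 2 + sinh (κ * t) ^ 2) * s0D (2 * κ ^ 2) t
      + s1D (2 * κ ^ 2) t * deriv (s0D (2 * κ ^ 2)) t = s2D (2 * κ ^ 2) t ^ 2 := by
  rw [(hasDerivAt_s0D hκ t).deriv, s0D_eq hκ, s1D_eq hκ, s2D_eq hκ]
  ring

theorem hasDerivAt_harnackXX {k t : ℝ} (hk : 0 < k) (ht : 0 < t) :
    HasDerivAt (harnackXX k) (2 * harnackXV k t ^ 2) t := by
  have h0 := (s0D_neg hk ht).ne
  unfold harnackXX harnackXV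
  obtain ⟨κ, hκ, rfl⟩ := exists_eq_two_mul_sq hk
  have hd := (hasDerivAt_s0D hκ t).differentiableAt.hasDerivAt
  refine (((hasDerivAt_s1D hκ t).div hd h0).neg.div_const 2).congr_deriv ?_
  rw [div_pow, div_pow, ← wronskian_s0D_s1D hκ]
  clear hd
  generalize s0D (2 * κ ^ 2) t = σ at *
  field_simp
  ring

theorem hasDerivAt_harnackXV {k t : ℝ} (hk : 0 < k) (ht : 0 < t) :
    HasDerivAt (harnackXV k) (2 * harnackXV k t * harnackVV k t - harnackXX k t) t := by
  have h0 := (s0D_neg hk ht).ne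
  unfold harnackXX harnackXV harnackVV
  obtain ⟨κ, hκ, rfl⟩ := exists_eq_two_mul_sq hk
  have hd := (hasDerivAt_s0D hκ t).differentiableAt.hasDerivAt
  refine (((hasDerivAt_s2D hκ t).div hd h0).div_const 2).congr_deriv ?_
  rw [← s1D_eq hκ]
  field_simp
  ring

theorem hasDerivAt_harnackVV {k t : ℝ} (hk : 0 < k) (ht : 0 < t) :
    HasDerivAt (harnackVV k) (2 * harnackVV k t ^ 2 - 2 * harnackXV k t - k) t := by
  have h0 := (s0D_neg hk ht).ne
  unfold harnackXV harnackVV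
  obtain ⟨κ, hκ, rfl⟩ := exists_eq_two_mul_sq hk
  have hd := (hasDerivAt_s0D hκ t).differentiableAt.hasDerivAt
  refine (((hasDerivAt_deriv_s0D hκ t).div hd h0).neg.div_const 2).congr_deriv ?_
  have key : -(8 * κ ^ 3 * t * sinh (κ * t) * cosh (κ * t)) =
      2 * s2D (2 * κ ^ 2) t + 4 * κ ^ 2 * s0D (2 * κ ^ 2) t := by
    rw [s0D_eq hκ, s2D_eq hκ]
    ring
  rw [key]
  field_simp
  ring

/-- A positive definite binary form is bounded below by the determinant over the trace. -/
theorem det_div_trace_le {a b d X P Y : ℝ} (ha : 0 < a) (hd : 0 < d)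
    (hX : 0 ≤ X) (hY : 0 ≤ Y) (hP : P ^ 2 ≤ X * Y) :
    (a * d - b ^ 2) / (a + d) * (X + Y) ≤ a * X + 2 * b * P + d * Y := by
  have had : 0 < a + d := by linarith
  rw [div_mul_eq_mul_div, div_le_iff₀ had]
  have h1 : (a ^ 2 + b ^ 2) * X + 2 * (b * (a + d)) * P + (d ^ 2 + b ^ 2) * Y ≥ 0 := by
    have key : ∀ α β : ℝ, 0 ≤ α ^ 2 * X + 2 * α * β * P + β ^ 2 * Y := by
      intro α β
      rcases hX.eq_or_lt with h | h
      · have hP0 : P = 0 := by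
          rw [← h, zero_mul] at hP
          exact pow_eq_zero_iff two_ne_zero |>.1 (le_antisymm hP (sq_nonneg P))
        rw [hP0, ← h]
        simp only [mul_zero, zero_add]
        positivity
      · refine (mul_nonneg_iff_of_pos_left h).1 ?_
        nlinarith [sq_nonneg (α * X + β * P), mul_nonneg (sq_nonneg β) (sub_nonneg.2 hP)]
    linarith [key a b, key b d]
  linarith

theorem harnack_form_le {k : ℝ} (hk : 0 < k) {T : ℝ} (hT : 0 < T) :
    ∃ c > 0, ∀ t ∈ Ioc 0 T, ∀ X P Y : ℝ, 0 ≤ X → 0 ≤ Y → P ^ 2 ≤ X * Y →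
      harnackXX k t * X + 2 * harnackXV k t * P + harnackVV k t * Y ≤ -(c / t) * (X + Y) := by
  obtain ⟨κ, hκ, rfl⟩ := exists_eq_two_mul_sq hk
  set C := cosh (κ * T) with hCdef
  have hC : 0 < C := cosh_pos _
  set M := 8 * κ ^ 4 * C ^ 2 + 4 * κ ^ 2 * C ^ 2 with hMdef
  have hM : 0 < M := by positivity
  refine ⟨4 * κ ^ 4 / M, by positivity, fun t ht X P Y hX hY hP => ?_⟩
  have h0 := s0D_neg hk ht.1
  have hw := wronskian_s0D_s1D hκ t
  have hx : 0 < κ * t := mul_pos hκ ht.1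
  have hsh := sinh_pos_iff.2 hx
  have hch := cosh_pos (κ * t)
  have hlt := sinh_lt_mul_cosh hx
  have hchC : cosh (κ * t) ≤ C := by
    rw [hCdef, cosh_le_cosh, abs_of_pos hx, abs_of_pos (mul_pos hκ hT)]
    exact mul_le_mul_of_nonneg_left ht.2 hκ.le
  have hs1 : s1D (2 * κ ^ 2) t < 0 := by
    rw [s1D_eq hκ, neg_lt_zero]
    positivity
  have hD : deriv (s0D (2 * κ ^ 2)) t < 0 := by
    rw [(hasDerivAt_s0D hκ t).deriv]
    have h1 := mul_pos (mul_pos hκ hch) (sub_pos.2 hlt)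
    have h2 := mul_pos (mul_pos hκ hx) (pow_pos hsh 2)
    linarith
  have hR : -(s1D (2 * κ ^ 2) t + deriv (s0D (2 * κ ^ 2)) t) ≤ M * t := by
    rw [(hasDerivAt_s0D hκ t).deriv, s1D_eq hκ]
    have ht0 := ht.1
    have h1 : sinh (κ * t) * cosh (κ * t) ≤ κ * t * C ^ 2 := by
      calc sinh (κ * t) * cosh (κ * t) ≤ κ * t * cosh (κ * t) * cosh (κ * t) := by gcongr
        _ ≤ κ * t * C * C := by gcongr
        _ = _ := by ring
    have h2 : cosh (κ * t) ^ 2 ≤ C ^ 2 := by gcongr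
    have h3 := cosh_sq (κ * t)
    have h4 : 8 * κ ^ 3 * (sinh (κ * t) * cosh (κ * t)) ≤ 8 * κ ^ 3 * (κ * t * C ^ 2) := by gcongr
    have h5 : 2 * κ ^ 2 * t * (cosh (κ * t) ^ 2 + sinh (κ * t) ^ 2) ≤
        2 * κ ^ 2 * t * (C ^ 2 + C ^ 2) :=
      mul_le_mul_of_nonneg_left (by linarith) (by positivity)
    have h6 : 0 < κ * (sinh (κ * t) * cosh (κ * t)) := by positivity
    rw [hMdef]
    linarith
  have hone : 1 ≤ cosh (κ * t) ^ 2 + sinh (κ * t) ^ 2 := by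
    nlinarith [one_le_cosh (κ * t), sq_nonneg (sinh (κ * t))]
  have hdet := det_div_trace_le (a := -harnackXX (2 * κ ^ 2) t) (b := -harnackXV (2 * κ ^ 2) t)
    (d := -harnackVV (2 * κ ^ 2) t) (X := X) (P := P) (Y := Y)
  unfold harnackXX harnackXV harnackVV at *
  generalize s0D (2 * κ ^ 2) t = σ, s1D (2 * κ ^ 2) t = σ₁, s2D (2 * κ ^ 2) t = σ₂,
    deriv (s0D (2 * κ ^ 2)) t = D, cosh (κ * t) ^ 2 + sinh (κ * t) ^ 2 = W at *
  have hσ : 0 < -σ := neg_pos.2 h0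
  have hRpos : 0 < -(σ₁ + D) := by linarith
  have hdet_eq : -(-(σ₁ / σ) / 2) * -(-(D / σ) / 2) - (-(σ₂ / σ / 2)) ^ 2 =
      8 * κ ^ 4 * W / (4 * -σ) := by
    rw [eq_div_iff (by positivity)]
    have h1 : (-(-(σ₁ / σ) / 2) * -(-(D / σ) / 2) - (-(σ₂ / σ / 2)) ^ 2) * (4 * -σ) =
        (σ₂ ^ 2 - σ₁ * D) / σ := by
      field_simp
      ring
    rw [h1, div_eq_iff h0.ne]
    linarith
  have htr_eq : -(-(σ₁ / σ) / 2) + -(-(D / σ) / 2) = -(σ₁ + D) / (2 * -σ) := by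
    field_simp
  have h1 := hdet (by linarith [div_pos_of_neg_of_neg hs1 h0])
    (by linarith [div_pos_of_neg_of_neg hD h0]) hX hY hP
  have hquot : 8 * κ ^ 4 * W / (4 * -σ) / (-(σ₁ + D) / (2 * -σ)) =
      4 * κ ^ 4 * W / -(σ₁ + D) := by
    rw [div_div_eq_mul_div, div_mul_eq_mul_div, div_div, div_eq_div_iff (by positivity) hRpos.ne']
    ring
  rw [hdet_eq, htr_eq, hquot] at h1
  have h2 : 4 * κ ^ 4 / M / t ≤ 4 * κ ^ 4 * W / -(σ₁ + D) := by
    rw [div_div]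
    exact div_le_div₀ (by positivity) (le_mul_of_one_le_right (by positivity) hone) hRpos hR
  have h3 := mul_le_mul_of_nonneg_right h2 (add_nonneg hX hY)
  linarith

end Riccati

section Propagation
open Filter Topology

/-- First and second derivatives of an exponential times a power of a quadratic polynomial. -/
theorem hasDerivAt_exp_mul_quadratic_pow (C b y p r : ℝ) (j : ℕ) (s : ℝ) :
    HasDerivAt (fun s => C * exp (-(b * s) / 2) * (y - p * s - r * s ^ 2) ^ (j + 2))
      (C * exp (-(b * s) / 2) * (y - p * s - r * s ^ 2) ^ (j + 1) *
        (-(b / 2) * (y - p * s - r * s ^ 2) - (j + 2) * (p + 2 * r * s))) s := by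
  have h1 : HasDerivAt (fun s : ℝ => exp (-(b * s) / 2)) (exp (-(b * s) / 2) * (-b / 2)) s := by
    refine ((((hasDerivAt_id s).const_mul b).neg.div_const 2).exp).congr_deriv ?_
    simp
  have h2 : HasDerivAt (fun s : ℝ => y - p * s - r * s ^ 2) (-p - 2 * r * s) s := by
    refine ((((hasDerivAt_id s).const_mul p).const_sub y).sub
      ((hasDerivAt_pow 2 s).const_mul r)).congr_deriv ?_
    simp only [Nat.cast_ofNat, Nat.reduceSub, pow_one, mul_one]
    ring
  refine ((h1.const_mul C).mul (h2.pow (j + 2))).congr_deriv ?_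
  simp only [Nat.cast_add, Nat.cast_ofNat, Pi.pow_apply, pow_succ,
    show j + 2 - 1 = j + 1 by rfl]
  ring

theorem hasDerivAt_deriv_exp_mul_quadratic_pow (C b y p r : ℝ) (j : ℕ) :
    HasDerivAt (fun s => C * exp (-(b * s) / 2) * (y - p * s - r * s ^ 2) ^ (j + 1) *
        (-(b / 2) * (y - p * s - r * s ^ 2) - (j + 2) * (p + 2 * r * s)))
      (C * y ^ j * (b ^ 2 / 4 * y ^ 2 + (j + 2) * (b * p) * y + (j + 2) * (j + 1) * p ^ 2
        - 2 * (j + 2) * r * y)) 0 := by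
  have h1 : HasDerivAt (fun s : ℝ => exp (-(b * s) / 2)) (-b / 2) 0 := by
    refine ((((hasDerivAt_id (0 : ℝ)).const_mul b).neg.div_const 2).exp).congr_deriv ?_
    simp
  have h2 : HasDerivAt (fun s : ℝ => y - p * s - r * s ^ 2) (-p) 0 := by
    refine ((((hasDerivAt_id (0 : ℝ)).const_mul p).const_sub y).sub
      ((hasDerivAt_pow 2 (0 : ℝ)).const_mul r)).congr_deriv ?_
    simp
  have h3 : HasDerivAt (fun s : ℝ => (j + 2 : ℝ) * (p + 2 * r * s)) ((j + 2) * (2 * r)) 0 := by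
    refine ((((hasDerivAt_id (0 : ℝ)).const_mul (2 * r)).const_add p).const_mul
      (j + 2 : ℝ)).congr_deriv ?_
    simp
  refine (((h1.const_mul C).mul (h2.pow (j + 1))).mul
    ((h2.const_mul (-(b / 2))).sub h3)).congr_deriv ?_
  simp only [Nat.add_sub_cancel, Nat.cast_add, Nat.cast_one, Pi.pow_apply, Pi.mul_apply,
    Pi.sub_apply,
    mul_zero, neg_zero, zero_div, exp_zero, mul_one, sub_zero, add_zero, ne_eq, OfNat.ofNat_ne_zero,
    not_false_eq_true, zero_pow]
  ring

variable {n : ℕ}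

/-- The quadratic form `μ (|ξ|² / r³ + |η - ξ / r|² / r)` adapted to the kinetic scaling. -/
def kineticForm (μ r : ℝ) (ξ η : E n) : ℝ :=
  μ * (2 * ‖ξ‖ ^ 2 / r ^ 3 - 2 * inner ℝ ξ η / r ^ 2 + ‖η‖ ^ 2 / r)

theorem norm_sub_smul_sq (ξ η : E n) (c : ℝ) :
    ‖η - c • ξ‖ ^ 2 = ‖η‖ ^ 2 - 2 * c * inner ℝ ξ η + c ^ 2 * ‖ξ‖ ^ 2 := by
  rw [norm_sub_sq_real, inner_smul_right, norm_smul, real_inner_comm, mul_pow, Real.norm_eq_abs,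
    sq_abs]
  ring

theorem kineticForm_eq {r : ℝ} (hr : 0 < r) (μ : ℝ) (ξ η : E n) :
    kineticForm μ r ξ η = μ * (‖ξ‖ ^ 2 / r ^ 3 + ‖η - r⁻¹ • ξ‖ ^ 2 / r) := by
  rw [kineticForm, norm_sub_smul_sq]
  field_simp
  ring

theorem kineticForm_nonneg {μ r : ℝ} (hμ : 0 ≤ μ) (hr : 0 < r) (ξ η : E n) :
    0 ≤ kineticForm μ r ξ η := by
  rw [kineticForm_eq hr]
  positivity

theorem norm_le_of_kineticForm_lt {μ r : ℝ} (hn : 1 ≤ n) (hμ : μ = 1 / (8 * n)) (hr : 0 < r)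
    (hr1 : r ≤ 1) {ξ η : E n} (h : kineticForm μ r ξ η < 1) :
    ‖ξ‖ ≤ 6 * √(n * r) ∧ ‖η‖ ≤ 6 * √(n * r) := by
  have hn0 : (0 : ℝ) < n := by exact_mod_cast hn
  rw [kineticForm_eq hr, hμ] at h
  have h0 : 0 ≤ ‖η - r⁻¹ • ξ‖ ^ 2 / r := by positivity
  have h0' : 0 ≤ ‖ξ‖ ^ 2 / r ^ 3 := by positivity
  rw [one_div, inv_mul_eq_div, div_lt_one (by positivity)] at h
  set S := √(n * r) with hS
  have hS0 : 0 ≤ S := Real.sqrt_nonneg _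
  have hS2 : S ^ 2 = n * r := Real.sq_sqrt (by positivity)
  have h1 : ‖r⁻¹ • ξ‖ ≤ 3 * S := by
    refine abs_le_of_sq_le_sq' ?_ (by positivity) |>.2
    rw [norm_smul, mul_pow, mul_pow, hS2, Real.norm_eq_abs, sq_abs]
    have : ‖ξ‖ ^ 2 / r ^ 3 * r ≤ 8 * n * r := by gcongr; linarith
    calc r⁻¹ ^ 2 * ‖ξ‖ ^ 2 = ‖ξ‖ ^ 2 / r ^ 3 * r := by field_simp
      _ ≤ 8 * n * r := this
      _ ≤ _ := by nlinarith [mul_pos hn0 hr]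
  have h2 : ‖η - r⁻¹ • ξ‖ ≤ 3 * S := by
    refine abs_le_of_sq_le_sq' ?_ (by positivity) |>.2
    rw [mul_pow, hS2]
    have : ‖η - r⁻¹ • ξ‖ ^ 2 / r * r ≤ 8 * n * r := by gcongr; linarith
    rw [div_mul_cancel₀ _ hr.ne'] at this
    nlinarith [mul_pos hn0 hr]
  constructor
  · have h3 : ‖ξ‖ = r * ‖r⁻¹ • ξ‖ := by
      rw [norm_smul, norm_inv, Real.norm_eq_abs, abs_of_pos hr, mul_inv_cancel_left₀ hr.ne']
    rw [h3]
    nlinarith [norm_nonneg (r⁻¹ • ξ)]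
  · have h3 := norm_sub_norm_le η (r⁻¹ • ξ)
    linarith

theorem kineticForm_add_smul {r : ℝ} (hr : 0 < r) (μ s : ℝ) (ξ η e : E n) :
    kineticForm μ r ξ (η + s • e) = kineticForm μ r ξ η
      + 2 * μ / r * inner ℝ (η - r⁻¹ • ξ) e * s + μ / r * ‖e‖ ^ 2 * s ^ 2 := by
  rw [kineticForm, kineticForm, norm_add_sq_real, inner_add_right, inner_smul_right,
    inner_smul_right, norm_smul, inner_sub_left, inner_smul_left, mul_pow, Real.norm_eq_abs, sq_abs]
  simp only [conj_trivial]
  field_simp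
  ring

theorem hasDerivAt_kineticForm {μ s : ℝ} {R : ℝ → ℝ} {ξ η : ℝ → E n} {β : E n} (hr : 0 < R s)
    (hR : HasDerivAt R (1 / 2) s) (hξ : HasDerivAt ξ (η s) s) (hη : HasDerivAt η (-β) s) :
    HasDerivAt (fun s => kineticForm μ (R s) (ξ s) (η s))
      (μ * (6 * inner ℝ (ξ s) (η s) / R s ^ 3 - 3 * ‖ξ s‖ ^ 2 / R s ^ 4
        - 5 / 2 * ‖η s‖ ^ 2 / R s ^ 2)
        - 2 * μ / R s * inner ℝ (η s - (R s)⁻¹ • ξ s) β) s := by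
  have h1 := hξ.norm_sq
  have h2 := hη.norm_sq
  have h3 := hξ.inner ℝ hη
  have hr' := hr.ne'
  unfold kineticForm
  refine (((((h1.const_mul 2).div (hR.pow 3) (pow_ne_zero 3 hr')).sub
    ((h3.const_mul 2).div (hR.pow 2) (pow_ne_zero 2 hr'))).add
    (h2.div hR hr')).const_mul μ).congr_deriv ?_
  simp only [Pi.pow_apply, inner_neg_right, inner_sub_left, inner_smul_left, conj_trivial,
    real_inner_self_eq_norm_sq]
  field_simp
  ring

/-- The key differential inequality for powers of `1 - kineticForm`. -/
theorem kineticForm_key {μ k r : ℝ} (hn : 1 ≤ n) (hμ : μ = 1 / (8 * n)) (hk : k = 8 * n + 1)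
    (hr : 0 < r) {ξ η : E n} {y : ℝ} (hy : y = 1 - kineticForm μ r ξ η) (hy0 : 0 ≤ y) :
    -(k * y * (μ * (6 * inner ℝ ξ η / r ^ 3 - 3 * ‖ξ‖ ^ 2 / r ^ 4 - 5 / 2 * ‖η‖ ^ 2 / r ^ 2)))
      + 2 * n * k * μ / r * y ≤
    k / (2 * r) * y ^ 2 + k * (k - 1) * (2 * μ / r) ^ 2 * ‖η - r⁻¹ • ξ‖ ^ 2 := by
  have hn0 : (0 : ℝ) < n := by exact_mod_cast hn
  have hk0 : 0 < k := by rw [hk]; positivity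
  have hμ0 : 0 < μ := by rw [hμ]; positivity
  have hμk : μ * (k - 1) = 1 := by rw [hμ, hk]; field_simp; ring
  have hμn : 8 * (n * μ) = 1 := by rw [hμ]; field_simp
  have hy1 : y ≤ 1 := by linarith [kineticForm_nonneg hμ0.le hr ξ η]
  have h1 : 0 ≤ ‖η - (r⁻¹ / 2) • ξ‖ ^ 2 / r := by positivity
  have hN : kineticForm μ r ξ η = 1 - y := by linarith
  rw [kineticForm_eq hr] at hN
  set A := ‖ξ‖ ^ 2 / r ^ 3 with hA
  set B := ‖η - r⁻¹ • ξ‖ ^ 2 / r with hB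
  set D := μ * (6 * inner ℝ ξ η / r ^ 3 - 3 * ‖ξ‖ ^ 2 / r ^ 4 - 5 / 2 * ‖η‖ ^ 2 / r ^ 2) with hD
  have hB0 : 0 ≤ B := by positivity
  have hDr : μ * (A / 4 - 15 / 4 * B) ≤ r * D := by
    have h2 : r * D - μ * (A / 4 - 15 / 4 * B) =
        μ * (‖η - (r⁻¹ / 2) • ξ‖ ^ 2 / r + B / 4) := by
      rw [hD, hA, hB, norm_sub_smul_sq, norm_sub_smul_sq]
      field_simp
      ring
    have h3 : 0 ≤ μ * (‖η - (r⁻¹ / 2) • ξ‖ ^ 2 / r + B / 4) := by positivity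
    linarith
  have hrr : r⁻¹ * r = 1 := inv_mul_cancel₀ hr.ne'
  have hlhs : -(k * y * D) + 2 * n * k * μ / r * y =
      (-(k * y * (r * D)) + k * y / 4) / r := by
    rw [eq_div_iff hr.ne']
    linear_combination (2 * n * k * μ * y) * hrr + (k * y / 4) * hμn
  have hrhs : k / (2 * r) * y ^ 2 + k * (k - 1) * (2 * μ / r) ^ 2 * ‖η - r⁻¹ • ξ‖ ^ 2 =
      (k / 2 * y ^ 2 + 4 * k * μ * B) / r := by
    rw [hB, eq_div_iff hr.ne']
    generalize ‖η - r⁻¹ • ξ‖ ^ 2 = G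
    linear_combination (k / 2 * y ^ 2 + 4 * μ ^ 2 * k * (k - 1) * G * r⁻¹) * hrr
      + (4 * k * μ * G * r⁻¹) * hμk
  rw [hlhs, hrhs]
  refine div_le_div_of_nonneg_right ?_ hr.le
  have h3 := mul_le_mul_of_nonneg_left hDr (mul_nonneg hk0.le hy0)
  have h4 : k * μ * B * y ≤ k * μ * B * 1 := by gcongr
  rw [show μ * (A / 4 - 15 / 4 * B) = (1 - y) / 4 - 4 * μ * B by linarith] at h3
  nlinarith [mul_nonneg hk0.le (sq_nonneg y)]

end Propagation

section PropagationBound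
open Filter Topology

variable {n : ℕ}

/-- Velocity at time `s` of the path with initial velocity `y₀` and acceleration `β₀ + s β₁`. -/
def pathVel (y₀ β₀ β₁ : E n) (s : ℝ) : E n := y₀ + s • β₀ + (s ^ 2 / 2) • β₁

/-- Position at time `s` of the path with velocity `pathVel y₀ β₀ β₁` started at `x₀`. -/
def pathPos (x₀ y₀ β₀ β₁ : E n) (s : ℝ) : E n :=
  x₀ + s • y₀ + (s ^ 2 / 2) • β₀ + (s ^ 3 / 6) • β₁

theorem hasDerivAt_pathVel (y₀ β₀ β₁ : E n) (s : ℝ) :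
    HasDerivAt (pathVel y₀ β₀ β₁) (β₀ + s • β₁) s := by
  refine ((((hasDerivAt_id s).smul_const β₀).const_add y₀).add
    (((hasDerivAt_pow 2 s).div_const 2).smul_const β₁)).congr_deriv ?_
  simp

theorem hasDerivAt_pathPos (x₀ y₀ β₀ β₁ : E n) (s : ℝ) :
    HasDerivAt (pathPos x₀ y₀ β₀ β₁) (pathVel y₀ β₀ β₁ s) s := by
  refine (((((hasDerivAt_id s).smul_const y₀).const_add x₀).add
    (((hasDerivAt_pow 2 s).div_const 2).smul_const β₀)).add
    (((hasDerivAt_pow 3 s).div_const 6).smul_const β₁)).congr_deriv ?_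
  rw [pathVel]
  simp only [one_smul, Nat.cast_ofNat, Nat.reduceSub, pow_one]
  module

theorem hasDerivAt_pow_mul_exp_mul_pow {R F Q : ℝ → ℝ} {L F' Q' s : ℝ} (j : ℕ) (hs : R s ≠ 0)
    (hR : HasDerivAt R (1 / 2) s) (hF : HasDerivAt F F' s) (hQ : HasDerivAt Q Q' s) :
    HasDerivAt (fun s => L * (R s ^ (j + 2))⁻¹ * exp (F s) * Q s ^ (j + 2))
      (L * (R s ^ (j + 2))⁻¹ * exp (F s) * Q s ^ j *
        (Q s ^ 2 * (-((j + 2) / (2 * R s)) + F') + (j + 2) * Q s * Q')) s := by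
  have hP := (hR.fun_pow (j + 2)).fun_inv (pow_ne_zero _ hs)
  refine (((hP.const_mul L).mul hF.exp).mul (hQ.fun_pow (j + 2))).congr_deriv ?_
  simp only [Pi.mul_apply, Nat.cast_add, Nat.cast_ofNat, show j + 2 - 1 = j + 1 by rfl]
  field_simp
  ring

/-- A compactly supported (where positive) subsolution moving along a controlled path. -/
def pathBump (L A σ : ℝ) (x₀ y₀ β₀ β₁ : E n) (s : ℝ) (z : E n × E n) : ℝ :=
  L * ((σ + s / 2) ^ (8 * n + 1))⁻¹ *
    exp (A * s - inner ℝ (β₀ + s • β₁) (z.2 - pathVel y₀ β₀ β₁ s) / 2) *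
    (1 - kineticForm (1 / (8 * n)) (σ + s / 2) (z.1 - pathPos x₀ y₀ β₀ β₁ s)
      (z.2 - pathVel y₀ β₀ β₁ s)) ^ (8 * n + 1)

theorem pathBump_add_smul {L A σ : ℝ} (x₀ y₀ β₀ β₁ : E n) {s : ℝ} (hs : 0 < σ + s / 2)
    (z : E n × E n) (e : E n) (τ : ℝ) :
    pathBump L A σ x₀ y₀ β₀ β₁ s (z + τ • ((0, e) : E n × E n)) =
      L * ((σ + s / 2) ^ (8 * n + 1))⁻¹ *
        exp (A * s - inner ℝ (β₀ + s • β₁) (z.2 - pathVel y₀ β₀ β₁ s) / 2) *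
        exp (-(inner ℝ (β₀ + s • β₁) e * τ) / 2) *
        ((1 - kineticForm (1 / (8 * n)) (σ + s / 2) (z.1 - pathPos x₀ y₀ β₀ β₁ s)
          (z.2 - pathVel y₀ β₀ β₁ s))
          - inner ℝ ((2 * (1 / (8 * n)) / (σ + s / 2)) • ((z.2 - pathVel y₀ β₀ β₁ s) -
            (σ + s / 2)⁻¹ • (z.1 - pathPos x₀ y₀ β₀ β₁ s))) e * τ
          - 1 / (8 * n) / (σ + s / 2) * ‖e‖ ^ 2 * τ ^ 2) ^ (8 * n + 1) := by
  have h1 : (z + τ • ((0, e) : E n × E n)).2 - pathVel y₀ β₀ β₁ s =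
      (z.2 - pathVel y₀ β₀ β₁ s) + τ • e := by
    simp only [Prod.snd_add, Prod.smul_snd]
    abel
  have h2 : (z + τ • ((0, e) : E n × E n)).1 = z.1 := by simp
  rw [pathBump, h1, h2, kineticForm_add_smul hs, mul_assoc _ (exp _) (exp _), ← exp_add,
    inner_add_right, inner_smul_right, inner_smul_left (𝕜 := ℝ)]
  simp only [conj_trivial]
  ring_nf

theorem hasDerivAt_pathBump {L A σ : ℝ} (x₀ y₀ β₀ β₁ : E n) {s : ℝ} (hs : 0 < σ + s / 2)
    (z : E n × E n) {ξ η : E n} (hξ : ξ = z.1 - pathPos x₀ y₀ β₀ β₁ s)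
    (hη : η = z.2 - pathVel y₀ β₀ β₁ s) {j : ℕ} (hj : 8 * n + 1 = j + 2) {y C : ℝ}
    (hy : y = 1 - kineticForm (1 / (8 * n)) (σ + s / 2) ξ η)
    (hC : C = L * ((σ + s / 2) ^ (8 * n + 1))⁻¹ * exp (A * s - inner ℝ (β₀ + s • β₁) η / 2)) :
    HasDerivAt (fun τ => pathBump L A σ x₀ y₀ β₀ β₁ τ (z + (τ - s) • (z.2, 0)))
      (C * y ^ j * (y ^ 2 * (-((8 * n + 1) / (2 * (σ + s / 2))) + A - inner ℝ β₁ η / 2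
          + ‖β₀ + s • β₁‖ ^ 2 / 2) -
        (8 * n + 1) * y * (1 / (8 * n) * (6 * inner ℝ ξ η / (σ + s / 2) ^ 3
          - 3 * ‖ξ‖ ^ 2 / (σ + s / 2) ^ 4 - 5 / 2 * ‖η‖ ^ 2 / (σ + s / 2) ^ 2)
          - inner ℝ ((2 * (1 / (8 * n)) / (σ + s / 2)) • (η - (σ + s / 2)⁻¹ • ξ))
            (β₀ + s • β₁)))) s := by
  have hV := hasDerivAt_pathVel y₀ β₀ β₁ s
  have hX := hasDerivAt_pathPos x₀ y₀ β₀ β₁ s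
  have hR : HasDerivAt (fun τ : ℝ => σ + τ / 2) (1 / 2) s :=
    ((hasDerivAt_id s).div_const 2).const_add σ
  have hβ : HasDerivAt (fun τ : ℝ => β₀ + τ • β₁) β₁ s := by
    simpa using ((hasDerivAt_id s).smul_const β₁).const_add β₀
  have hηd : HasDerivAt (fun τ => z.2 - pathVel y₀ β₀ β₁ τ) (-(β₀ + s • β₁)) s := hV.const_sub _
  have hξd : HasDerivAt (fun τ => z.1 + (τ - s) • z.2 - pathPos x₀ y₀ β₀ β₁ τ)
      (z.2 - pathVel y₀ β₀ β₁ s) s := by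
    refine (((((hasDerivAt_id s).sub_const s).smul_const z.2).const_add z.1).sub hX).congr_deriv ?_
    simp
  have hN := hasDerivAt_kineticForm (μ := 1 / (8 * n)) (R := fun τ : ℝ => σ + τ / 2) (s := s)
    hs hR hξd hηd
  have hF : HasDerivAt (fun τ => A * τ - inner ℝ (β₀ + τ • β₁) (z.2 - pathVel y₀ β₀ β₁ τ) / 2)
      (A - inner ℝ β₁ η / 2 + ‖β₀ + s • β₁‖ ^ 2 / 2) s := by
    refine (((hasDerivAt_id s).const_mul A).sub ((hβ.inner ℝ hηd).div_const 2)).congr_deriv ?_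
    rw [inner_neg_right, real_inner_self_eq_norm_sq, ← hη]
    ring
  have hj' : (8 * n + 1 : ℝ) = j + 2 := by exact_mod_cast hj
  have h := hasDerivAt_pow_mul_exp_mul_pow (L := L) (R := fun τ => σ + τ / 2) j hs.ne' hR hF
    (hN.const_sub 1)
  have hfun : (fun τ => pathBump L A σ x₀ y₀ β₀ β₁ τ (z + (τ - s) • (z.2, 0))) =
      fun τ => L * ((σ + τ / 2) ^ (j + 2))⁻¹ *
        exp (A * τ - inner ℝ (β₀ + τ • β₁) (z.2 - pathVel y₀ β₀ β₁ τ) / 2) *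
        (1 - kineticForm (1 / (8 * n)) (σ + τ / 2) (z.1 + (τ - s) • z.2 - pathPos x₀ y₀ β₀ β₁ τ)
          (z.2 - pathVel y₀ β₀ β₁ τ)) ^ (j + 2) := by
    funext τ
    simp [pathBump, hj]
  rw [hfun]
  refine h.congr_deriv ?_
  rw [hj] at hC
  simp only [sub_self, zero_smul, add_zero, ← hξ, ← hη, ← hy, hj', inner_smul_left (𝕜 := ℝ),
    conj_trivial, hC]
  ring

end PropagationBound

section PropagationTheorem
open Filter Topology

variable {n : ℕ}

theorem inner_single_right (u : E n) (i : Fin n) :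
    inner ℝ u (EuclideanSpace.single i (1 : ℝ)) = u i := by
  simp [EuclideanSpace.inner_single_right]

theorem norm_single_one (i : Fin n) : ‖EuclideanSpace.single i (1 : ℝ)‖ = 1 := by simp

theorem continuous_kineticForm {X : Type*} [TopologicalSpace X] {S : Set X} {μ : ℝ} {R : X → ℝ}
    {ξ η : X → E n} (hR : ContinuousOn R S) (hR0 : ∀ x ∈ S, R x ≠ 0) (hξ : ContinuousOn ξ S)
    (hη : ContinuousOn η S) : ContinuousOn (fun x => kineticForm μ (R x) (ξ x) (η x)) S := by
  unfold kineticForm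
  have h1 := fun x hx => pow_ne_zero 3 (hR0 x hx)
  have h2 := fun x hx => pow_ne_zero 2 (hR0 x hx)
  fun_prop (disch := assumption)

theorem continuousOn_pathBump {L A σ : ℝ} (hσ : 0 < σ) (x₀ y₀ β₀ β₁ : E n) :
    ContinuousOn (fun q : ℝ × (E n × E n) => pathBump L A σ x₀ y₀ β₀ β₁ q.1 q.2)
      (Icc 0 1 ×ˢ univ) := by
  have h0 : ∀ q ∈ Icc (0 : ℝ) 1 ×ˢ (univ : Set (E n × E n)), σ + q.1 / 2 ≠ 0 := fun q hq => by
    have := hq.1.1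
    positivity
  have h1 : ∀ q ∈ Icc (0 : ℝ) 1 ×ˢ (univ : Set (E n × E n)), (σ + q.1 / 2) ^ (8 * n + 1) ≠ 0 :=
    fun q hq => pow_ne_zero _ (h0 q hq)
  unfold pathBump pathPos pathVel
  have h2 := continuous_kineticForm (n := n) (μ := 1 / (8 * n))
    (S := Icc (0 : ℝ) 1 ×ˢ (univ : Set (E n × E n))) (R := fun q => σ + q.1 / 2)
    (ξ := fun q => q.2.1 - (x₀ + q.1 • y₀ + (q.1 ^ 2 / 2) • β₀ + (q.1 ^ 3 / 6) • β₁))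
    (η := fun q => q.2.2 - (y₀ + q.1 • β₀ + (q.1 ^ 2 / 2) • β₁))
    (by fun_prop) h0 (by fun_prop) (by fun_prop)
  fun_prop (disch := assumption)

set_option maxHeartbeats 1000000 in
theorem pathBump_not_touch (hn : 1 ≤ n) {φ h : E n × E n → ℝ} (hφ : ContDiff ℝ (⊤ : ℕ∞) φ)
    (hpos : ∀ z, 0 < φ z) (hst : ∀ z, lapV φ z = fderiv ℝ φ z (z.2, 0) - h z * φ z)
    {x₀ y₀ β₀ β₁ : E n} {L b σ κ : ℝ} (hL : 0 < L) (hσ : 0 < σ) (hσ' : σ ≤ 1 / 2)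
    (hb : ∀ s ∈ Icc (0 : ℝ) 1, ‖β₀ + s • β₁‖ ≤ b) (hb₁ : ‖β₁‖ ≤ b)
    (hκ : ∀ s ∈ Icc (0 : ℝ) 1, ∀ z : E n × E n, ‖z.1 - pathPos x₀ y₀ β₀ β₁ s‖ ≤ 6 * √n →
      ‖z.2 - pathVel y₀ β₀ β₁ s‖ ≤ 6 * √n → κ ≤ h z)
    {s : ℝ} (hs : s ∈ Ioc (0 : ℝ) 1) (z : E n × E n)
    (hz : φ z - pathBump L (κ - 1 - b ^ 2 / 4 - 3 * b * √n) σ x₀ y₀ β₀ β₁ s z = 0)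
    (hle : ∀ τ ∈ Icc 0 s, ∀ w,
      0 ≤ φ w - pathBump L (κ - 1 - b ^ 2 / 4 - 3 * b * √n) σ x₀ y₀ β₀ β₁ τ w) : False := by
  set A := κ - 1 - b ^ 2 / 4 - 3 * b * √n with hA
  obtain ⟨j, hj⟩ : ∃ j, 8 * n + 1 = j + 2 := ⟨8 * n - 1, by omega⟩
  have hj' : (8 * n + 1 : ℝ) = j + 2 := by exact_mod_cast hj
  have hR : 0 < σ + s / 2 := by linarith [hs.1]
  have hR1 : σ + s / 2 ≤ 1 := by linarith [hs.2]
  set ξ := z.1 - pathPos x₀ y₀ β₀ β₁ s with hξ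
  set η := z.2 - pathVel y₀ β₀ β₁ s with hη
  set μ : ℝ := 1 / (8 * n) with hμ
  set y := 1 - kineticForm μ (σ + s / 2) ξ η with hy
  set C := L * ((σ + s / 2) ^ (8 * n + 1))⁻¹ * exp (A * s - inner ℝ (β₀ + s • β₁) η / 2) with hC
  have hC0 : 0 < C := by positivity
  have hval : φ z = C * y ^ (8 * n + 1) := by linarith [hz, show pathBump L A σ x₀ y₀ β₀ β₁ s z =
    C * y ^ (8 * n + 1) from rfl]
  have hy0 : 0 < y := by
    have hodd : Odd (8 * n + 1) := ⟨4 * n, by ring⟩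
    exact hodd.pow_pos_iff.1 ((mul_pos_iff_of_pos_left hC0).1 (hval ▸ hpos z))
  set P := (2 * μ / (σ + s / 2)) • (η - (σ + s / 2)⁻¹ • ξ) with hP
  set β := β₀ + s • β₁ with hβ
  -- second derivatives in the velocity directions
  have hsecond : ∀ i : Fin n, C * y ^ j * ((β i) ^ 2 / 4 * y ^ 2 + (j + 2) * (β i * P i) * y
      + (j + 2) * (j + 1) * (P i) ^ 2 - 2 * (j + 2) * (μ / (σ + s / 2)) * y) ≤
      dirDeriv2 φ (stdBasis n (Sum.inr i)) z := by
    intro i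
    have hline : ∀ τ : ℝ, pathBump L A σ x₀ y₀ β₀ β₁ s (z + τ • stdBasis n (Sum.inr i)) =
        C * exp (-(β i * τ) / 2) * (y - P i * τ - μ / (σ + s / 2) * τ ^ 2) ^ (j + 2) := by
      intro τ
      have h := pathBump_add_smul (L := L) (A := A) x₀ y₀ β₀ β₁ hR z
        (EuclideanSpace.single i (1 : ℝ)) τ
      rw [inner_single_right, inner_single_right, hj, norm_single_one, one_pow, mul_one] at h
      rw [hC, hj]
      exact h
    have hφl : ∀ τ, HasDerivAt (fun τ : ℝ => φ (z + τ • stdBasis n (Sum.inr i))) _ τ :=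
      hasDerivAt_line (differentiable_of_smooth hφ) z _
    have hmin : IsLocalMin (fun τ : ℝ => φ (z + τ • stdBasis n (Sum.inr i)) -
        C * exp (-(β i * τ) / 2) * (y - P i * τ - μ / (σ + s / 2) * τ ^ 2) ^ (j + 2)) 0 := by
      refine Eventually.of_forall fun τ => ?_
      simp only [← hline]
      rw [zero_smul, add_zero, hz]
      exact hle s ⟨hs.1.le, le_rfl⟩ _
    have h2 := second_deriv_nonneg_of_isLocalMin hmin
      (Eventually.of_forall fun τ => (hφl τ).sub (hasDerivAt_exp_mul_quadratic_pow C (β i) y (P i)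
        (μ / (σ + s / 2)) j τ))
      ((hasDerivAt_line2 hφ z _ 0).sub (hasDerivAt_deriv_exp_mul_quadratic_pow C (β i) y (P i)
        (μ / (σ + s / 2)) j))
    rw [zero_smul, add_zero] at h2
    linarith
  have hlap : C * y ^ j * (‖β‖ ^ 2 / 4 * y ^ 2 + (j + 2) * inner ℝ P β * y
      + (j + 2) * (j + 1) * ‖P‖ ^ 2 - 2 * n * (j + 2) * (μ / (σ + s / 2)) * y) ≤ lapV φ z := by
    rw [lapV_eq_sum]
    refine le_of_eq_of_le ?_ (Finset.sum_le_sum fun i _ => hsecond i)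
    rw [← Finset.mul_sum]
    congr 1
    simp only [Finset.sum_add_distrib, Finset.sum_sub_distrib, ← Finset.sum_mul, ← Finset.mul_sum,
      ← Finset.sum_div, EuclideanSpace.real_norm_sq_eq, PiLp.inner_apply, RCLike.inner_apply,
      conj_trivial, Finset.sum_const, Finset.card_univ, Fintype.card_fin, nsmul_eq_mul]
    ring
  -- derivative along the characteristic curve
  have hcurve := hasDerivAt_pathBump (L := L) (A := A) x₀ y₀ β₀ β₁ hR z hξ hη hj hy hC
  have hφc : HasDerivAt (fun τ : ℝ => φ (z + (τ - s) • ((z.2, 0) : E n × E n)))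
      (fderiv ℝ φ z (z.2, 0)) s := by
    have h := (hasDerivAt_line (differentiable_of_smooth hφ) z (z.2, 0) (s - s)).comp_sub_const s s
    simpa using h
  have htime := deriv_nonpos_of_nonneg_left hs.1
    (u := fun τ => φ (z + (τ - s) • ((z.2, 0) : E n × E n)) -
      pathBump L A σ x₀ y₀ β₀ β₁ τ (z + (τ - s) • (z.2, 0)))
    (fun τ hτ => hle τ hτ _) (by simpa using hz) (hφc.sub hcurve)
  have hkey := kineticForm_key hn hμ rfl hR hy hy0.le
  have hball := norm_le_of_kineticForm_lt hn hμ hR hR1 (ξ := ξ) (η := η) (by linarith)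
  have hsq : √(n * (σ + s / 2)) ≤ √n :=
    Real.sqrt_le_sqrt (mul_le_of_le_one_right (by positivity) hR1)
  have hh := hκ s ⟨hs.1.le, hs.2⟩ z (by linarith [hball.1]) (by linarith [hball.2])
  have hbs := hb s ⟨hs.1.le, hs.2⟩
  have hin : -(inner ℝ β₁ η) ≤ b * (6 * √n) := by
    refine (neg_le_abs _).trans ((abs_real_inner_le_norm _ _).trans ?_)
    gcongr
    · exact (norm_nonneg _).trans hb₁
    · linarith [hball.2]
  have hb2 : ‖β‖ ^ 2 ≤ b ^ 2 := by gcongr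
  have hst' := hst z
  have hPsq : ‖P‖ ^ 2 = (2 * μ / (σ + s / 2)) ^ 2 * ‖η - (σ + s / 2)⁻¹ • ξ‖ ^ 2 := by
    rw [hP, norm_smul, mul_pow, Real.norm_eq_abs, sq_abs]
  have hκφ : κ * (C * y ^ j * y ^ 2) ≤ h z * φ z := by
    rw [hval, hj, pow_add y j 2, ← mul_assoc C]
    gcongr
  have hc : 0 < C * y ^ j := by positivity
  have hmain := le_of_mul_le_mul_left (a := C * y ^ j) (b := ‖β‖ ^ 2 / 4 * y ^ 2
      + (j + 2) * inner ℝ P β * y + (j + 2) * (j + 1) * ‖P‖ ^ 2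
      - 2 * n * (j + 2) * (μ / (σ + s / 2)) * y)
    (c := (y ^ 2 * (-((8 * n + 1) / (2 * (σ + s / 2))) + A - inner ℝ β₁ η / 2 + ‖β‖ ^ 2 / 2) -
        (8 * n + 1) * y * (μ * (6 * inner ℝ ξ η / (σ + s / 2) ^ 3 - 3 * ‖ξ‖ ^ 2 / (σ + s / 2) ^ 4
          - 5 / 2 * ‖η‖ ^ 2 / (σ + s / 2) ^ 2) - inner ℝ P β)) - κ * y ^ 2) (by linarith) hc
  rw [hPsq] at hmain
  generalize μ * (6 * inner ℝ ξ η / (σ + s / 2) ^ 3 - 3 * ‖ξ‖ ^ 2 / (σ + s / 2) ^ 4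
          - 5 / 2 * ‖η‖ ^ 2 / (σ + s / 2) ^ 2) = D at hmain hkey
  rw [hj'] at hmain hkey
  have h1 : (0 : ℝ) ≤ y ^ 2 * (A - κ - inner ℝ β₁ η / 2 + ‖β‖ ^ 2 / 4) := by
    have h2 : (j + 2 : ℝ) * (j + 2 - 1) = (j + 2) * (j + 1) := by ring
    rw [h2] at hkey
    have h3 : 2 * n * (j + 2) * μ / (σ + s / 2) * y = 2 * n * (j + 2) * (μ / (σ + s / 2)) * y := by
      ring
    have h4 : (j + 2 : ℝ) / (2 * (σ + s / 2)) * y ^ 2 = y ^ 2 * ((j + 2) / (2 * (σ + s / 2))) := by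
      ring
    rw [h3, h4] at hkey
    linarith
  have h2 : A - κ - inner ℝ β₁ η / 2 + ‖β‖ ^ 2 / 4 ≤ -1 := by
    rw [hA]
    linarith
  nlinarith [pow_pos hy0 2]

theorem norm_pathVel_le (y₀ β₀ β₁ : E n) {s : ℝ} (hs : s ∈ Icc (0 : ℝ) 1) :
    ‖pathVel y₀ β₀ β₁ s‖ ≤ ‖y₀‖ + ‖β₀‖ + ‖β₁‖ := by
  unfold pathVel
  refine (norm_add₃_le).trans ?_
  have h1 : s ^ 2 / 2 ≤ 1 := by nlinarith [hs.1, hs.2]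
  rw [norm_smul, norm_smul, Real.norm_of_nonneg hs.1, Real.norm_of_nonneg (by positivity)]
  have h2 := mul_le_of_le_one_left (norm_nonneg β₀) hs.2
  have h3 := mul_le_of_le_one_left (norm_nonneg β₁) h1
  linarith

theorem norm_pathPos_le (x₀ y₀ β₀ β₁ : E n) {s : ℝ} (hs : s ∈ Icc (0 : ℝ) 1) :
    ‖pathPos x₀ y₀ β₀ β₁ s‖ ≤ ‖x₀‖ + ‖y₀‖ + ‖β₀‖ + ‖β₁‖ := by
  unfold pathPos
  refine (norm_add₄_le).trans ?_
  have h0 := hs.1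
  have h1 : s ^ 2 / 2 ≤ 1 := by nlinarith [hs.1, hs.2]
  have h1' : s ^ 3 / 6 ≤ 1 := by
    have := pow_le_one₀ (n := 3) hs.1 hs.2
    linarith
  rw [norm_smul, norm_smul, norm_smul, Real.norm_of_nonneg hs.1,
    Real.norm_of_nonneg (by positivity), Real.norm_of_nonneg (by positivity)]
  have h2 := mul_le_of_le_one_left (norm_nonneg y₀) hs.2
  have h3 := mul_le_of_le_one_left (norm_nonneg β₀) h1
  have h4 := mul_le_of_le_one_left (norm_nonneg β₁) h1'
  linarith

/-- Propagation of lower bounds of positive solutions of `Δ_v φ - ⟨v, ∇_x φ⟩ + h φ = 0` along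
controlled paths. -/
theorem propagation_lower_bound (hn : 1 ≤ n) {φ h : E n × E n → ℝ} (hφ : ContDiff ℝ (⊤ : ℕ∞) φ)
    (hpos : ∀ z, 0 < φ z) (hst : ∀ z, lapV φ z = fderiv ℝ φ z (z.2, 0) - h z * φ z)
    (x₀ y₀ β₀ β₁ : E n) {L b σ κ : ℝ} (hL : 0 < L) (hσ : 0 < σ) (hσ' : σ ≤ 1 / 2)
    (hb : ∀ s ∈ Icc (0 : ℝ) 1, ‖β₀ + s • β₁‖ ≤ b) (hb₁ : ‖β₁‖ ≤ b)
    (hκ : ∀ s ∈ Icc (0 : ℝ) 1, ∀ z : E n × E n, ‖z.1 - pathPos x₀ y₀ β₀ β₁ s‖ ≤ 6 * √n →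
      ‖z.2 - pathVel y₀ β₀ β₁ s‖ ≤ 6 * √n → κ ≤ h z)
    (hLφ : ∀ z : E n × E n, ‖z.1 - x₀‖ ≤ 6 * √(n * σ) → ‖z.2 - y₀‖ ≤ 6 * √(n * σ) → L < φ z) :
    L * σ ^ (8 * n + 1) * exp (κ - 1 - b ^ 2 / 4 - 6 * b * √n) ≤
      φ (pathPos x₀ y₀ β₀ β₁ 1, pathVel y₀ β₀ β₁ 1) := by
  set A := κ - 1 - b ^ 2 / 4 - 3 * b * √n with hA
  set L₀ := L * σ ^ (8 * n + 1) * exp (-(3 * b * √n)) with hL₀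
  have hL₀pos : 0 < L₀ := by positivity
  set m : ℝ → E n × E n → ℝ := fun s z => φ z - pathBump L₀ A σ x₀ y₀ β₀ β₁ s z with hm
  have hb0 : 0 ≤ b := (norm_nonneg _).trans hb₁
  have hodd : Odd (8 * n + 1) := ⟨4 * n, by ring⟩
  have hX0 : pathPos x₀ y₀ β₀ β₁ 0 = x₀ := by simp [pathPos]
  have hV0 : pathVel y₀ β₀ β₁ 0 = y₀ := by simp [pathVel]
  have hsupp : ∀ s ∈ Icc (0 : ℝ) 1, ∀ z, m s z ≤ 0 →
      0 < 1 - kineticForm (1 / (8 * n)) (σ + s / 2) (z.1 - pathPos x₀ y₀ β₀ β₁ s)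
        (z.2 - pathVel y₀ β₀ β₁ s) := by
    intro s hs z hz
    have h0 := hs.1
    have h1 : 0 < pathBump L₀ A σ x₀ y₀ β₀ β₁ s z := by
      have := hpos z
      simp only [hm] at hz
      linarith
    rw [pathBump, mul_pos_iff_of_pos_left (by positivity)] at h1
    exact hodd.pow_pos_iff.1 h1
  have hstart : ∀ z, 0 < m 0 z := by
    intro z
    by_contra! hz
    have h1 := hsupp 0 ⟨le_rfl, zero_le_one⟩ z hz
    rw [zero_div, add_zero, hX0, hV0] at h1
    have h2 := norm_le_of_kineticForm_lt hn rfl hσ (by linarith) (sub_pos.1 h1)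
    have h3 := hLφ z h2.1 h2.2
    have h4 : pathBump L₀ A σ x₀ y₀ β₀ β₁ 0 z ≤ L := by
      have h5 : √(n * σ) ≤ √n :=
        Real.sqrt_le_sqrt (mul_le_of_le_one_right (by positivity) (by linarith))
      have h6 : -(inner ℝ β₀ (z.2 - y₀)) ≤ b * (6 * √n) := by
        refine (neg_le_abs _).trans ((abs_real_inner_le_norm _ _).trans ?_)
        have := hb 0 ⟨le_rfl, zero_le_one⟩
        rw [zero_smul, add_zero] at this
        gcongr
        linarith [h2.2]
      have hμ0 : (0 : ℝ) ≤ 1 / (8 * n) := by positivity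
      have h7 : (1 - kineticForm (1 / (8 * n)) σ (z.1 - x₀) (z.2 - y₀)) ^ (8 * n + 1) ≤ 1 :=
        pow_le_one₀ h1.le (by linarith [kineticForm_nonneg hμ0 hσ (z.1 - x₀) (z.2 - y₀)])
      rw [pathBump, zero_div, add_zero, hX0, hV0, zero_smul, add_zero, mul_zero, zero_sub]
      refine (mul_le_of_le_one_right (by positivity) h7).trans ?_
      have h8 : L₀ * (σ ^ (8 * n + 1))⁻¹ = L * exp (-(3 * b * √n)) := by
        rw [hL₀]
        field_simp
      rw [h8, mul_assoc, ← exp_add]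
      refine mul_le_of_le_one_right hL.le (exp_le_one_iff.2 ?_)
      linarith
    simp only [hm] at hz
    linarith
  have hnot : ¬ ∃ s ∈ Icc (0 : ℝ) 1, ∃ z, m s z ≤ 0 := by
    intro hex
    have hin : ∀ s ∈ Icc (0 : ℝ) 1, ∀ z, m s z ≤ 0 →
        z ∈ Metric.closedBall (0 : E n × E n) (‖x₀‖ + ‖y₀‖ + ‖β₀‖ + ‖β₁‖ + 6 * √n) := by
      intro s hs z hz
      have h1 := hsupp s hs z hz
      have h0 := hs.1
      have hR1 : σ + s / 2 ≤ 1 := by linarith [hs.2]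
      have h2 := norm_le_of_kineticForm_lt hn rfl (by positivity) hR1 (sub_pos.1 h1)
      have h5 : √(n * (σ + s / 2)) ≤ √n :=
        Real.sqrt_le_sqrt (mul_le_of_le_one_right (by positivity) hR1)
      rw [mem_closedBall_zero_iff, Prod.norm_def, max_le_iff]
      have h6 := norm_le_norm_add_norm_sub' z.1 (pathPos x₀ y₀ β₀ β₁ s)
      have h7 := norm_le_norm_add_norm_sub' z.2 (pathVel y₀ β₀ β₁ s)
      have h8 := norm_pathPos_le x₀ y₀ β₀ β₁ hs
      have h9 := norm_pathVel_le y₀ β₀ β₁ hs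
      constructor
      · linarith [h2.1]
      · linarith [h2.2, norm_nonneg x₀]
    have hcont : ContinuousOn (fun q : ℝ × (E n × E n) => m q.1 q.2) (Icc 0 1 ×ˢ univ) :=
      (hφ.continuous.comp continuous_snd).continuousOn.sub
        (continuousOn_pathBump (L := L₀) (A := A) hσ x₀ y₀ β₀ β₁)
    obtain ⟨s, hs, z, hz, hle⟩ := exists_first_touch
      (isCompact_closedBall (0 : E n × E n) (‖x₀‖ + ‖y₀‖ + ‖β₀‖ + ‖β₁‖ + 6 * √n))
      hcont hin hstart hex
    exact pathBump_not_touch hn hφ hpos hst hL₀pos hσ hσ' hb hb₁ hκ hs z hz hle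
  push Not at hnot
  have h1 := hnot 1 ⟨zero_le_one, le_rfl⟩ (pathPos x₀ y₀ β₀ β₁ 1, pathVel y₀ β₀ β₁ 1)
  refine le_trans ?_ (sub_pos.1 h1).le
  simp only [pathBump, sub_self, inner_zero_right, zero_div, sub_zero, kineticForm, norm_zero]
  norm_num
  rw [hL₀, hA]
  have h2 : (1 : ℝ) ≤ ((σ + 1 / 2) ^ (8 * n + 1))⁻¹ :=
    (one_le_inv₀ (by positivity)).2 (pow_le_one₀ (by positivity) (by linarith))
  calc L * σ ^ (8 * n + 1) * exp (κ - 1 - b ^ 2 / 4 - 6 * b * √n)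
      = L * σ ^ (8 * n + 1) * exp (-(3 * b * √n)) * 1 *
        exp (κ - 1 - b ^ 2 / 4 - 3 * b * √n) := by
        rw [mul_one, mul_assoc _ (exp _) (exp _), ← exp_add]
        congr 2
        ring
    _ ≤ _ := by gcongr

end PropagationTheorem

section Growth
open Filter Topology

variable {n : ℕ}

theorem affine_sq_le (a b r : ℝ) : (a * r + b) ^ 2 ≤ (a ^ 2 + b ^ 2) * (1 + r ^ 2) := by
  nlinarith [sq_nonneg (a - b * r)]

/-- Around a suitable direction, a linear functional is nonnegative on product balls. -/
theorem exists_dual_direction (l : E n × E n →L[ℝ] ℝ) :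
    ∃ u : E n × E n, ‖u.1‖ ≤ 1 ∧ ‖u.2‖ ≤ 1 ∧ ∀ (c d : ℝ) (ζ : E n × E n),
      ‖ζ.1 - c • u.1‖ ≤ c → ‖ζ.2 - d • u.2‖ ≤ d → 0 ≤ l ζ := by
  have key : ∀ l : E n →L[ℝ] ℝ, ∃ u : E n, ‖u‖ ≤ 1 ∧ ∀ (c : ℝ) (e : E n),
      ‖e - c • u‖ ≤ c → 0 ≤ l e := by
    intro l
    set p := (InnerProductSpace.toDual ℝ (E n)).symm l with hp
    have hl : ∀ e, l e = inner ℝ p e := fun e => by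
      rw [hp, InnerProductSpace.toDual_symm_apply]
    have hu : ‖‖p‖⁻¹ • p‖ ≤ 1 := by
      rw [norm_smul, norm_inv, norm_norm]
      exact inv_mul_le_one
    refine ⟨‖p‖⁻¹ • p, hu, fun c e he => ?_⟩
    have h1 : inner ℝ p (‖p‖⁻¹ • p) = ‖p‖ := by
      rw [real_inner_smul_right, real_inner_self_eq_norm_sq]
      rcases eq_or_ne ‖p‖ 0 with h | h
      · simp [h]
      · field_simp
    have h2 := abs_le.1 (abs_real_inner_le_norm p (e - c • (‖p‖⁻¹ • p)))
    have h3 : inner ℝ p e = c * ‖p‖ + inner ℝ p (e - c • (‖p‖⁻¹ • p)) := by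
      rw [inner_sub_right, real_inner_smul_right p (‖p‖⁻¹ • p) c, h1]
      ring
    rw [hl, h3]
    nlinarith [norm_nonneg p, h2.1]
  obtain ⟨u, hu, hu'⟩ := key (l.comp (ContinuousLinearMap.inl ℝ _ _))
  obtain ⟨v, hv, hv'⟩ := key (l.comp (ContinuousLinearMap.inr ℝ _ _))
  refine ⟨(u, v), hu, hv, fun c d ζ h1 h2 => ?_⟩
  have h3 := add_nonneg (hu' c _ h1) (hv' d _ h2)
  rw [ContinuousLinearMap.comp_apply, ContinuousLinearMap.comp_apply, ← map_add] at h3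
  simpa using h3

theorem hfun_taylor {h : E n × E n → ℝ} {k : ℝ} (hh : ContDiff ℝ (⊤ : ℕ∞) h)
    (hk : ∀ z ζ, -(k * ‖ζ.2‖ ^ 2) ≤ dirDeriv2 h ζ z) (z ζ : E n × E n) :
    h z + fderiv ℝ h z ζ - k * ‖ζ.2‖ ^ 2 / 2 ≤ h (z + ζ) :=
  taylor_lower_bound hh fun _ _ => hk _ _

theorem exists_quadratic_lower_bound {h : E n × E n → ℝ} {k : ℝ} (hk0 : 0 ≤ k)
    (hh : ContDiff ℝ (⊤ : ℕ∞) h) (hk : ∀ z ζ, -(k * ‖ζ.2‖ ^ 2) ≤ dirDeriv2 h ζ z) :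
    ∃ C, 0 ≤ C ∧ ∀ z, -(C * (1 + ‖z‖ ^ 2)) ≤ h z := by
  refine ⟨|h 0| + ‖fderiv ℝ h 0‖ + k, by positivity, fun z => ?_⟩
  have h1 := hfun_taylor hh hk 0 z
  rw [zero_add] at h1
  have h2 := neg_le_of_abs_le ((fderiv ℝ h 0).le_opNorm z)
  have h3 := neg_abs_le (h 0)
  have h4 : k * ‖z.2‖ ^ 2 ≤ k * ‖z‖ ^ 2 := by
    gcongr
    exact norm_snd_le z
  have h5 : ‖z‖ ≤ 1 + ‖z‖ ^ 2 := by nlinarith [sq_nonneg (‖z‖ - 1), norm_nonneg z]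
  have h6 := mul_le_mul_of_nonneg_left h5 (norm_nonneg (fderiv ℝ h 0))
  have h7 := abs_nonneg (h 0)
  nlinarith [sq_nonneg ‖z‖]

/-- The product box of radius `6 √(n σ)` around `c`. -/
def velBox (n : ℕ) (σ : ℝ) (c : E n × E n) : Set (E n × E n) :=
  {z | ‖z.1 - c.1‖ ≤ 6 * √(n * σ) ∧ ‖z.2 - c.2‖ ≤ 6 * √(n * σ)}

variable {w h : E n × E n → ℝ}

theorem log_propagation_join (hn : 1 ≤ n) (hw : ContDiff ℝ (⊤ : ℕ∞) w)
    (hst : ∀ z, lapV (fun z => exp (w z)) z =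
      fderiv ℝ (fun z => exp (w z)) z (z.2, 0) - h z * exp (w z))
    {C : ℝ} (hC : 0 ≤ C) (hlow : ∀ z, -(C * (1 + ‖z‖ ^ 2)) ≤ h z) :
    ∃ K, 0 ≤ K ∧ ∀ (M σ l : ℝ) (p q : E n × E n), ‖p‖ ≤ M → ‖q‖ ≤ M → 0 < σ → σ ≤ 1 / 2 →
      (∀ z ∈ velBox n σ p, l < w z) → l + (8 * n + 1) * log σ - K * (1 + M ^ 2) ≤ w q := by
  refine ⟨C * (1 + (72 ^ 2 + (6 * √n) ^ 2)) + 1 + 70 ^ 2 / 4 + 6 * 70 * √n, by positivity,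
    fun M σ l p q hp hq hσ hσ' hl => ?_⟩
  have hM : 0 ≤ M := (norm_nonneg p).trans hp
  have hp1 := (norm_fst_le p).trans hp
  have hp2 := (norm_snd_le p).trans hp
  have hq1 := (norm_fst_le q).trans hq
  have hq2 := (norm_snd_le q).trans hq
  set D₁ := q.2 - p.2 with hD₁
  set D₂ := q.1 - p.1 - p.2 with hD₂
  have hD₁n : ‖D₁‖ ≤ 2 * M := (norm_sub_le _ _).trans (by linarith)
  have hD₂n : ‖D₂‖ ≤ 3 * M := (norm_sub_le _ _).trans
    (by linarith [norm_sub_le q.1 p.1])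
  set β₀ : E n := (6 : ℝ) • D₂ - (2 : ℝ) • D₁ with hβ₀
  set β₁ : E n := (6 : ℝ) • D₁ - (12 : ℝ) • D₂ with hβ₁
  have hβ₀n : ‖β₀‖ ≤ 22 * M := (norm_sub_le _ _).trans (by
    rw [norm_smul, norm_smul, Real.norm_of_nonneg (by norm_num), Real.norm_of_nonneg (by norm_num)]
    linarith)
  have hβ₁n : ‖β₁‖ ≤ 48 * M := (norm_sub_le _ _).trans (by
    rw [norm_smul, norm_smul, Real.norm_of_nonneg (by norm_num), Real.norm_of_nonneg (by norm_num)]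
    linarith)
  have hmain := propagation_lower_bound (φ := fun z => exp (w z)) (h := h) hn
    (Real.contDiff_exp.comp hw) (fun z => exp_pos _) hst p.1 p.2 β₀ β₁ (L := exp l) (b := 70 * M)
    (σ := σ) (κ := -(C * (1 + (72 * M + 6 * √n) ^ 2))) (exp_pos l) hσ hσ' ?_ (by linarith) ?_
    fun z h1 h2 => exp_lt_exp.2 (hl z ⟨h1, h2⟩)
  · have hend : (pathPos p.1 p.2 β₀ β₁ 1, pathVel p.2 β₀ β₁ 1) = q := by
      refine Prod.ext ?_ ?_
      · simp only [pathPos, hβ₀, hβ₁, hD₂, hD₁]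
        module
      · simp only [pathVel, hβ₀, hβ₁, hD₂, hD₁]
        module
    rw [hend, ← exp_log (pow_pos hσ (8 * n + 1)), ← exp_add, ← exp_add, exp_le_exp,
      Real.log_pow] at hmain
    push_cast at hmain
    refine le_trans ?_ hmain
    have h1 := mul_le_mul_of_nonneg_left (affine_sq_le 72 (6 * √n) M) hC
    have h2 : M ≤ 1 + M ^ 2 := by nlinarith [sq_nonneg (M - 1)]
    have h3 := mul_le_mul_of_nonneg_left h2 (Real.sqrt_nonneg n)
    nlinarith [sq_nonneg M, mul_nonneg hC (sq_nonneg M)]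
  · intro s hs
    refine (norm_add_le _ _).trans ?_
    rw [norm_smul, Real.norm_of_nonneg hs.1]
    have := mul_le_of_le_one_left (norm_nonneg β₁) hs.2
    linarith
  · intro s hs z h1 h2
    refine le_trans ?_ (hlow z)
    have h3 : ‖z‖ ≤ 72 * M + 6 * √n := by
      rw [Prod.norm_def, max_le_iff]
      have h6 := norm_le_norm_add_norm_sub' z.1 (pathPos p.1 p.2 β₀ β₁ s)
      have h7 := norm_le_norm_add_norm_sub' z.2 (pathVel p.2 β₀ β₁ s)
      have h8 := norm_pathPos_le p.1 p.2 β₀ β₁ hs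
      have h9 := norm_pathVel_le p.2 β₀ β₁ hs
      constructor <;> linarith
    gcongr

theorem exists_log_lower_bound (hw : ContDiff ℝ (⊤ : ℕ∞) w) {K : ℝ} (hK : 0 ≤ K)
    (hjoin : ∀ (M σ l : ℝ) (p q : E n × E n), ‖p‖ ≤ M → ‖q‖ ≤ M → 0 < σ → σ ≤ 1 / 2 →
      (∀ z ∈ velBox n σ p, l < w z) → l + (8 * n + 1) * log σ - K * (1 + M ^ 2) ≤ w q) :
    ∃ C, 0 ≤ C ∧ ∀ z, -(C * (1 + ‖z‖ ^ 2)) ≤ w z := by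
  obtain ⟨l, hl⟩ := (isCompact_closedBall (0 : E n × E n) (6 * √n)).bddBelow_image
    (f := w) hw.continuous.continuousOn
  set c := |l - 1 + (8 * n + 1) * log (1 / 2)| with hc
  refine ⟨c + K, by positivity, fun z => ?_⟩
  have h1 := hjoin ‖z‖ (1 / 2) (l - 1) 0 z (by simp) le_rfl (by norm_num) le_rfl ?_
  · have h2 : 0 ≤ c := abs_nonneg _
    have h3 := neg_abs_le (l - 1 + (8 * n + 1) * log (1 / 2))
    rw [← hc] at h3
    nlinarith [sq_nonneg ‖z‖]
  · intro y hy
    have h2 : l ≤ w y := hl ⟨y, ?_, rfl⟩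
    · linarith
    · have h3 : √(n * (1 / 2)) ≤ √n :=
        Real.sqrt_le_sqrt (mul_le_of_le_one_right (by positivity) (by norm_num))
      obtain ⟨h4, h5⟩ := hy
      rw [Prod.fst_zero, sub_zero] at h4
      rw [Prod.snd_zero, sub_zero] at h5
      rw [mem_closedBall_zero_iff, Prod.norm_def, max_le_iff]
      constructor <;> linarith

theorem exists_log_upper_bound (hw : ContDiff ℝ (⊤ : ℕ∞) w) {K : ℝ} (hK : 0 ≤ K)
    (hjoin : ∀ (M σ l : ℝ) (p q : E n × E n), ‖p‖ ≤ M → ‖q‖ ≤ M → 0 < σ → σ ≤ 1 / 2 →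
      (∀ z ∈ velBox n σ p, l < w z) → l + (8 * n + 1) * log σ - K * (1 + M ^ 2) ≤ w q)
    {a₀ a₁ : ℝ} (ha₀ : 0 < a₀) (ha₁ : 0 < a₁)
    (hw2 : ∀ z ζ, -(a₀ * exp (a₁ * (‖z.1‖ ^ 2 + ‖z.2‖ ^ 2)) * (‖ζ.1‖ ^ 2 + ‖ζ.2‖ ^ 2)) ≤
      dirDeriv2 w ζ z) :
    ∃ C, 0 ≤ C ∧ ∀ z, w z ≤ C * (1 + ‖z‖ ^ 2) := by
  set Q := 1 + a₀ * exp (a₁ * (576 * n)) * (288 * n) with hQ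
  have hQ1 : 1 ≤ Q := le_add_of_nonneg_right (by positivity)
  set c := |w 0 + 1 + (8 * n + 1) * log (2 * Q)| with hc
  refine ⟨c + (8 * n + 1) * (4 * a₁) + K * (1 + (1 ^ 2 + (6 * √n) ^ 2)), by positivity,
    fun z₀ => ?_⟩
  set σ := exp (-(4 * a₁ * ‖z₀‖ ^ 2)) / (2 * Q) with hσ
  have hσ0 : 0 < σ := by positivity
  have hexp1 : exp (-(4 * a₁ * ‖z₀‖ ^ 2)) ≤ 1 := exp_le_one_iff.2 (by
    have : 0 ≤ 4 * a₁ * ‖z₀‖ ^ 2 := by positivity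
    linarith)
  have hσ1 : σ ≤ 1 / 2 := by
    rw [hσ, div_le_div_iff₀ (by positivity) (by norm_num)]
    linarith
  obtain ⟨u, hu1, hu2, hu⟩ := exists_dual_direction (fderiv ℝ w z₀)
  set d := 6 * √(n * σ) with hd
  have hd0 : 0 ≤ d := by positivity
  have hdn : d ≤ 6 * √n := by
    rw [hd]
    gcongr
    exact mul_le_of_le_one_right (by positivity) (by linarith)
  have hd2 : d ^ 2 = 36 * (n * σ) := by
    rw [hd, mul_pow, Real.sq_sqrt (by positivity)]
    norm_num
  have hstart : ‖z₀ + d • u‖ ≤ 1 * ‖z₀‖ + 6 * √n := by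
    refine (norm_add_le _ _).trans ?_
    rw [norm_smul, Real.norm_of_nonneg hd0]
    have := mul_le_of_le_one_right hd0 (show ‖u‖ ≤ 1 from by
      rw [Prod.norm_def]; exact max_le hu1 hu2)
    linarith
  have h1 := hjoin (1 * ‖z₀‖ + 6 * √n) σ (w z₀ - 1) (z₀ + d • u) 0 hstart
    (by rw [norm_zero]; positivity) hσ0 hσ1 ?_
  · rw [hσ, Real.log_div (by positivity) (by positivity), Real.log_exp] at h1
    have h2 := mul_le_mul_of_nonneg_left (affine_sq_le 1 (6 * √n) ‖z₀‖) hK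
    have h3 := le_abs_self (w 0 + 1 + (8 * n + 1) * log (2 * Q))
    rw [← hc] at h3
    have h4 : 0 ≤ c := abs_nonneg _
    have h5 : 0 ≤ (8 * n + 1) * (4 * a₁) := by positivity
    have h6 := mul_nonneg h4 (sq_nonneg ‖z₀‖)
    have h7 := mul_nonneg hK (sq_nonneg ‖z₀‖)
    linarith
  · rintro z ⟨hz1, hz2⟩
    rw [← hd] at hz1 hz2
    set ζ := z - z₀ with hζ
    have hz : z = z₀ + ζ := by rw [hζ]; abel
    have hζ1 : ‖ζ.1 - d • u.1‖ ≤ d := by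
      convert hz1 using 2
      simp only [hζ, Prod.fst_sub, Prod.fst_add, Prod.smul_fst]
      abel
    have hζ2 : ‖ζ.2 - d • u.2‖ ≤ d := by
      convert hz2 using 2
      simp only [hζ, Prod.snd_sub, Prod.snd_add, Prod.smul_snd]
      abel
    have hn1 : ‖ζ.1‖ ≤ 2 * d := by
      have h2 := norm_le_norm_add_norm_sub' ζ.1 (d • u.1)
      rw [norm_smul, Real.norm_of_nonneg hd0] at h2
      linarith [mul_le_of_le_one_right hd0 hu1]
    have hn2 : ‖ζ.2‖ ≤ 2 * d := by
      have h2 := norm_le_norm_add_norm_sub' ζ.2 (d • u.2)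
      rw [norm_smul, Real.norm_of_nonneg hd0] at h2
      linarith [mul_le_of_le_one_right hd0 hu2]
    have hl := hu d d ζ hζ1 hζ2
    have ht := taylor_lower_bound hw (z := z₀) (ζ := ζ) (c := 1) ?_
    · rw [hz]
      linarith
    · intro s hs
      refine le_trans (neg_le_neg ?_) (hw2 _ _)
      have hζn : ‖s • ζ‖ ≤ 2 * d := by
        rw [norm_smul, Real.norm_of_nonneg hs.1]
        refine (mul_le_of_le_one_left (norm_nonneg _) hs.2).trans ?_
        rw [Prod.norm_def]
        exact max_le hn1 hn2
      have h3 : ‖z₀ + s • ζ‖ ≤ ‖z₀‖ + 2 * d := (norm_add_le _ _).trans (by linarith)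
      have h4 := (norm_fst_le (z₀ + s • ζ)).trans h3
      have h5 := (norm_snd_le (z₀ + s • ζ)).trans h3
      have h6 : ‖(z₀ + s • ζ).1‖ ^ 2 + ‖(z₀ + s • ζ).2‖ ^ 2 ≤ 4 * ‖z₀‖ ^ 2 + 576 * n := by
        have h7 := pow_le_pow_left₀ (norm_nonneg _) h4 2
        have h8 := pow_le_pow_left₀ (norm_nonneg _) h5 2
        have h9 : (n : ℝ) * σ ≤ n * (1 / 2) := by gcongr
        nlinarith [sq_nonneg (‖z₀‖ - 2 * d)]
      calc a₀ * exp (a₁ * (‖(z₀ + s • ζ).1‖ ^ 2 + ‖(z₀ + s • ζ).2‖ ^ 2)) *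
            (‖ζ.1‖ ^ 2 + ‖ζ.2‖ ^ 2)
          ≤ a₀ * exp (a₁ * (4 * ‖z₀‖ ^ 2 + 576 * n)) * ((2 * d) ^ 2 + (2 * d) ^ 2) := by gcongr
        _ = (Q - 1) * (exp (4 * a₁ * ‖z₀‖ ^ 2) * exp (-(4 * a₁ * ‖z₀‖ ^ 2))) / (2 * Q) := by
            rw [mul_add a₁, exp_add, show ((2 * d) ^ 2 + (2 * d) ^ 2 : ℝ) = 8 * d ^ 2 by ring, hd2,
              hσ, hQ]
            ring_nf
        _ ≤ 1 := by
            rw [← exp_add, add_neg_cancel, exp_zero, mul_one, div_le_one (by positivity)]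
            linarith

theorem exists_quadratic_upper_bound (hn : 1 ≤ n) (hw : ContDiff ℝ (⊤ : ℕ∞) w)
    (hst : ∀ z, lapV (fun z => exp (w z)) z =
      fderiv ℝ (fun z => exp (w z)) z (z.2, 0) - h z * exp (w z))
    {k : ℝ} (hk0 : 0 ≤ k) (hh : ContDiff ℝ (⊤ : ℕ∞) h)
    (hk : ∀ z ζ, -(k * ‖ζ.2‖ ^ 2) ≤ dirDeriv2 h ζ z)
    {C₁ C₂ : ℝ} (hC₁ : 0 ≤ C₁) (hC₂ : 0 ≤ C₂) (hlow : ∀ z, -(C₁ * (1 + ‖z‖ ^ 2)) ≤ w z)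
    (hup : ∀ z, w z ≤ C₂ * (1 + ‖z‖ ^ 2)) :
    ∃ C, 0 ≤ C ∧ ∀ z, h z ≤ C * (1 + ‖z‖ ^ 2) := by
  set d := 6 * √n with hd
  have hd0 : 0 ≤ d := by positivity
  set c := |2 * k * d ^ 2 + 2 + (8 * n + 1) * log 2| with hc
  have hc0 : 0 ≤ c := abs_nonneg _
  refine ⟨c + (C₁ + C₂) * (1 + (3 ^ 2 + (6 * d) ^ 2)), by positivity, fun z₀ => ?_⟩
  obtain ⟨u, hu1, hu2, hu⟩ := exists_dual_direction (fderiv ℝ h z₀)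
  set Y := z₀.2 + d • u.2 with hY
  have hYn : ‖Y‖ ≤ ‖z₀‖ + d := by
    refine (norm_add_le _ _).trans ?_
    rw [norm_smul, Real.norm_of_nonneg hd0]
    linarith [mul_le_of_le_one_right hd0 hu2, norm_snd_le z₀]
  set M := ‖Y‖ + d with hM
  have hM0 : 0 ≤ M := by positivity
  set X := z₀.1 + M • u.1 with hX
  have hXn : ‖X‖ ≤ 2 * ‖z₀‖ + 2 * d := by
    refine (norm_add_le _ _).trans ?_
    rw [norm_smul, Real.norm_of_nonneg hM0]
    linarith [mul_le_of_le_one_right hM0 hu1, norm_fst_le z₀]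
  set R := 3 * ‖z₀‖ + 6 * d with hR
  have hR0 : 0 ≤ R := by positivity
  have hpath : ∀ s, pathPos X Y 0 0 s = X + s • Y := fun s => by simp [pathPos]
  have hvel : ∀ s, pathVel Y 0 0 s = Y := fun s => by simp [pathVel]
  have hmain := propagation_lower_bound (φ := fun z => exp (w z)) (h := h) hn
    (Real.contDiff_exp.comp hw) (fun z => exp_pos _) hst X Y 0 0
    (L := exp (-(C₁ * (1 + R ^ 2)) - 1)) (b := 0) (σ := 1 / 2) (κ := h z₀ - 2 * k * d ^ 2)
    (exp_pos _) (by norm_num) le_rfl (by simp) (by simp) ?_ ?_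
  · rw [hpath, hvel, one_smul, ← exp_log (pow_pos (one_half_pos (α := ℝ)) (8 * n + 1)), ← exp_add,
      ← exp_add, exp_le_exp, Real.log_pow, one_div, Real.log_inv] at hmain
    push_cast at hmain
    have h1 : ‖(X + Y, Y)‖ ≤ R := by
      rw [Prod.norm_def, max_le_iff]
      refine ⟨(norm_add_le _ _).trans ?_, ?_⟩
      · show _ ≤ R
        linarith
      · show _ ≤ R
        linarith [norm_nonneg z₀]
    have h2 : w (X + Y, Y) ≤ C₂ * (1 + R ^ 2) := (hup _).trans (by gcongr)
    have h3 := mul_le_mul_of_nonneg_left (affine_sq_le 3 (6 * d) ‖z₀‖) (add_nonneg hC₁ hC₂)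
    have h4 := le_abs_self (2 * k * d ^ 2 + 2 + (8 * n + 1) * log 2)
    rw [← hc] at h4
    have h5 := mul_nonneg hc0 (sq_nonneg ‖z₀‖)
    have h6 := mul_nonneg (add_nonneg hC₁ hC₂) (sq_nonneg ‖z₀‖)
    rw [hR] at hmain h2
    linarith
  · intro s hs z hz1 hz2
    rw [hpath, ← hd] at hz1
    rw [hvel, ← hd] at hz2
    have h1 := hfun_taylor hh hk z₀ (z - z₀)
    rw [add_sub_cancel] at h1
    have hζ1 : ‖(z - z₀).1 - M • u.1‖ ≤ M := by
      have h2 : (z - z₀).1 - M • u.1 = (z.1 - (X + s • Y)) + s • Y := by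
        simp only [Prod.fst_sub, hX]
        abel
      rw [h2]
      refine (norm_add_le _ _).trans ?_
      rw [norm_smul, Real.norm_of_nonneg hs.1]
      linarith [mul_le_of_le_one_left (norm_nonneg Y) hs.2]
    have hζ2 : ‖(z - z₀).2 - d • u.2‖ ≤ d := by
      convert hz2 using 2
      simp only [Prod.snd_sub, hY]
      abel
    have hn2 : ‖(z - z₀).2‖ ≤ 2 * d := by
      have h2 := norm_le_norm_add_norm_sub' (z - z₀).2 (d • u.2)
      rw [norm_smul, Real.norm_of_nonneg hd0] at h2
      linarith [mul_le_of_le_one_right hd0 hu2]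
    have h3 := hu M d _ hζ1 hζ2
    have h4 : k * ‖(z - z₀).2‖ ^ 2 ≤ k * (2 * d) ^ 2 := by gcongr
    linarith
  · intro z hz1 hz2
    refine exp_lt_exp.2 (lt_of_lt_of_le (sub_one_lt _) (le_trans (neg_le_neg ?_) (hlow z)))
    have h1 : 6 * √(n * (1 / 2)) ≤ d := by
      rw [hd]
      gcongr
      exact mul_le_of_le_one_right (by positivity) (by norm_num)
    have h2 := norm_le_norm_add_norm_sub' z.1 X
    have h3 := norm_le_norm_add_norm_sub' z.2 Y
    have h4 : ‖z‖ ≤ R := by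
      rw [Prod.norm_def, max_le_iff]
      constructor <;> linarith [norm_nonneg z₀]
    gcongr

end Growth

section GroundState
open Filter Topology

variable {n : ℕ}

theorem pd_exp_mul {w g : E n × E n → ℝ} (hw : ContDiff ℝ (⊤ : ℕ∞) w)
    (hg : ContDiff ℝ (⊤ : ℕ∞) g) (j : Fin n ⊕ Fin n) :
    pd (fun z => exp (w z) * g z) j = fun z => exp (w z) * (pd w j z * g z + pd g j z) := by
  ext z
  have h := ((differentiable_of_smooth hw z).hasFDerivAt.exp.mul
    (differentiable_of_smooth hg z).hasFDerivAt).fderiv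
  rw [pd, show (fun z => exp (w z) * g z) = (fun z => exp (w z)) * g from rfl, h]
  simp only [_root_.add_apply, _root_.smul_apply, smul_eq_mul, pd]
  ring

theorem pd_pd_exp_mul {w g : E n × E n → ℝ} (hw : ContDiff ℝ (⊤ : ℕ∞) w)
    (hg : ContDiff ℝ (⊤ : ℕ∞) g) (j : Fin n ⊕ Fin n) (z : E n × E n) :
    pd (pd (fun z => exp (w z) * g z) j) j z = exp (w z) * ((pd (pd w j) j z + pd w j z ^ 2) * g z
      + 2 * pd w j z * pd g j z + pd (pd g j) j z) := by
  have h1 := contDiff_pd hw j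
  have h2 := contDiff_pd hg j
  have h3 : pd (fun z => pd w j z * g z + pd g j z) j z =
      pd (pd w j) j z * g z + pd w j z * pd g j z + pd (pd g j) j z := by
    have h := (((differentiable_of_smooth h1 z).hasFDerivAt.mul
      (differentiable_of_smooth hg z).hasFDerivAt).add
      (differentiable_of_smooth h2 z).hasFDerivAt).fderiv
    rw [pd, show (fun z => pd w j z * g z + pd g j z) = pd w j * g + pd g j from rfl, h]
    simp only [_root_.add_apply, _root_.smul_apply, smul_eq_mul, pd]
    ring
  rw [pd_exp_mul hw hg, pd_exp_mul hw ((h1.mul hg).add h2)]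
  simp only [h3]
  ring

theorem pd_neg_half {U : E n × E n → ℝ} (hU : ContDiff ℝ (⊤ : ℕ∞) U) (j : Fin n ⊕ Fin n) :
    pd (fun z => -U z / 2) j = fun z => -pd U j z / 2 := by
  ext z
  have h : (fun z => -U z / 2) = fun z => (-1 / 2 : ℝ) * U z := by
    ext
    ring
  rw [pd, h, fderiv_const_mul (differentiable_of_smooth hU z)]
  simp only [_root_.smul_apply, smul_eq_mul, pd]
  ring

/-- Conjugation of the kinetic operator by `e^{-U/2}` removes the drift and creates the
potential `hfun U`. -/
theorem exp_neg_half_mul_generator {U g : E n × E n → ℝ} (hU : ContDiff ℝ (⊤ : ℕ∞) U)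
    (hg : ContDiff ℝ (⊤ : ℕ∞) g) (z : E n × E n) :
    lapV (fun z => exp (-U z / 2) * g z) z -
        fderiv ℝ (fun z => exp (-U z / 2) * g z) z (z.2, 0) + hfun U z * (exp (-U z / 2) * g z) =
      exp (-U z / 2) * (lapV g z - (∑ i : Fin n, pd U (Sum.inr i) z * pd g (Sum.inr i) z)
          - ∑ i : Fin n, z.2 i * pd g (Sum.inl i) z) := by
  have hw : ContDiff ℝ (⊤ : ℕ∞) fun z => -U z / 2 := (hU.neg).div_const 2
  rw [transport_eq_sum, hfun, lapV, lapV, lapV]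
  simp only [pd_pd_exp_mul hw hg]
  simp only [pd_exp_mul hw hg, pd_neg_half hU, pd_neg_half (contDiff_pd hU _)]
  have h1 : hfun U z = ∑ i : Fin n, (-(1 / 2) * (z.2 i * pd U (Sum.inl i) z) +
      (1 / 2) * pd (pd U (Sum.inr i)) (Sum.inr i) z - (1 / 4) * pd U (Sum.inr i) z ^ 2) := by
    rw [hfun, lapV]
    simp only [Finset.sum_add_distrib, Finset.sum_sub_distrib, Finset.mul_sum]
  rw [hfun, lapV] at h1
  rw [h1]
  simp only [Finset.sum_mul, Finset.mul_sum, mul_sub, ← Finset.sum_add_distrib,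
    ← Finset.sum_sub_distrib]
  refine Finset.sum_congr rfl fun i _ => ?_
  ring

theorem exp_neg_half_stationary {U : E n × E n → ℝ} (hU : ContDiff ℝ (⊤ : ℕ∞) U) (z : E n × E n) :
    lapV (fun z => exp (-U z / 2)) z =
      fderiv ℝ (fun z => exp (-U z / 2)) z (z.2, 0) - hfun U z * exp (-U z / 2) := by
  have h := exp_neg_half_mul_generator hU (g := fun _ => (1 : ℝ)) contDiff_const z
  have h1 : ∀ j, pd (fun _ : E n × E n => (1 : ℝ)) j = fun _ => 0 := fun j => by
    ext z
    simp [pd]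
  have h2 : ∀ j, pd (fun _ : E n × E n => (0 : ℝ)) j = fun _ => 0 := fun j => by
    ext z
    simp [pd]
  have h3 : lapV (fun _ : E n × E n => (1 : ℝ)) z = 0 := by simp [lapV, h1, h2]
  simp only [mul_one, h3, h1, mul_zero, Finset.sum_const_zero, sub_zero] at h
  linarith

theorem dirDeriv2_neg_half {U : E n × E n → ℝ} (hU : ContDiff ℝ (⊤ : ℕ∞) U) (ζ z : E n × E n) :
    dirDeriv2 (fun z => -U z / 2) ζ z = -dirDeriv2 U ζ z / 2 := by
  have h : ∀ g : E n × E n → ℝ, ContDiff ℝ (⊤ : ℕ∞) g → ∀ y,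
      fderiv ℝ (fun z => -g z / 2) y ζ = -fderiv ℝ g y ζ / 2 := by
    intro g hg y
    have h1 : (fun z => -g z / 2) = fun z => (-1 / 2 : ℝ) * g z := by
      ext
      ring
    rw [h1, fderiv_const_mul (differentiable_of_smooth hg y)]
    simp only [_root_.smul_apply, smul_eq_mul]
    ring
  rw [dirDeriv2, dirDeriv2]
  simp only [h U hU]
  exact h _ (contDiff_fderiv_apply hU ζ) z

section SpaceTime

variable {T : ℝ} {f : ℝ → E n × E n → ℝ}

theorem contDiff_slice
    (hf : ContDiffOn ℝ (⊤ : ℕ∞) (fun q : ℝ × (E n × E n) => f q.1 q.2) (Ioo 0 T ×ˢ univ))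
    {t : ℝ} (ht : t ∈ Ioo 0 T) : ContDiff ℝ (⊤ : ℕ∞) (f t) := by
  rw [← contDiffOn_univ]
  exact hf.comp (g := fun q : ℝ × (E n × E n) => f q.1 q.2) (f := fun z => (t, z))
    (contDiff_const.prodMk contDiff_id).contDiffOn fun z _ => ⟨ht, mem_univ _⟩

theorem hasDerivAt_curve
    (hf : ContDiffOn ℝ (⊤ : ℕ∞) (fun q : ℝ × (E n × E n) => f q.1 q.2) (Ioo 0 T ×ˢ univ))
    {t : ℝ} (ht : t ∈ Ioo 0 T) {γ : ℝ → E n × E n} {ζ : E n × E n} (hγ : HasDerivAt γ ζ t) :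
    HasDerivAt (fun τ => f τ (γ τ)) (deriv (fun τ => f τ (γ t)) t + fderiv ℝ (f t) (γ t) ζ) t := by
  have hopen : IsOpen (Ioo 0 T ×ˢ (univ : Set (E n × E n))) := isOpen_Ioo.prod isOpen_univ
  have hd : DifferentiableAt ℝ (fun q : ℝ × (E n × E n) => f q.1 q.2) (t, γ t) :=
    ((hf.differentiableOn (by simp)) (t, γ t) ⟨ht, mem_univ _⟩).differentiableAt
      (hopen.mem_nhds ⟨ht, mem_univ _⟩)
  have h1 : HasDerivAt (fun τ => f τ (γ t)) (fderiv ℝ (fun q : ℝ × (E n × E n) => f q.1 q.2)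
      (t, γ t) (1, 0)) t :=
    hd.hasFDerivAt.comp_hasDerivAt (f := fun τ => (τ, γ t)) t
      ((hasDerivAt_id t).prodMk (hasDerivAt_const t _))
  have h2 : HasFDerivAt (f t) ((fderiv ℝ (fun q : ℝ × (E n × E n) => f q.1 q.2)
      (t, γ t)).comp (ContinuousLinearMap.inr ℝ ℝ (E n × E n))) (γ t) :=
    hd.hasFDerivAt.comp (f := fun z => (t, z)) (γ t) (hasFDerivAt_prodMk_right t (γ t))
  have h3 := hd.hasFDerivAt.comp_hasDerivAt (f := fun τ => (τ, γ τ)) t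
    ((hasDerivAt_id t).prodMk hγ)
  rw [h1.deriv, h2.fderiv, ContinuousLinearMap.comp_apply, ContinuousLinearMap.inr_apply, ← map_add]
  exact h3.congr_deriv (by simp)

end SpaceTime

theorem exists_solution_bound {T : ℝ} {w : E n × E n → ℝ} {ρ : ℝ → E n × E n → ℝ}
    (hρ : ContDiffOn ℝ (⊤ : ℕ∞) (fun q : ℝ × (E n × E n) => ρ q.1 q.2) (Ioo 0 T ×ˢ univ))
    {a₀ : ℝ} (ha₀ : 0 < a₀)
    (hgrow : ∀ t ∈ Ioo 0 T, ∀ p : E n × E n,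
      √(gradNormSq (ρ t) p) ≤ a₀ * exp (w p) * (‖p.1‖ + ‖p.2‖))
    {C : ℝ} (hC : 0 ≤ C) (hw : ∀ z, w z ≤ C * (1 + ‖z‖ ^ 2)) {t₀ t₁ : ℝ} (ht₀ : 0 < t₀)
    (ht₁ : t₁ < T) :
    ∃ K, 0 ≤ K ∧ ∀ t ∈ Icc t₀ t₁, ∀ z, exp (w z) * ρ t z ≤ exp (K * (1 + ‖z‖ ^ 2)) := by
  have hsub : ∀ t ∈ Icc t₀ t₁, t ∈ Ioo 0 T := fun t ht => ⟨ht₀.trans_le ht.1, ht.2.trans_lt ht₁⟩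
  have hcont : ContinuousOn (fun t => ρ t 0) (Icc t₀ t₁) :=
    hρ.continuousOn.comp (g := fun q : ℝ × (E n × E n) => ρ q.1 q.2) (f := fun t => (t, 0))
      (by fun_prop) fun t ht => ⟨hsub t ht, mem_univ _⟩
  obtain ⟨M, hM⟩ := isCompact_Icc.bddAbove_image hcont
  refine ⟨C + (|M| + 4 * a₀ + C), by positivity, fun t ht z => ?_⟩
  have hsm := contDiff_slice hρ (hsub t ht)
  obtain ⟨s, hs, h1⟩ := exists_hasDerivAt_eq_slope (fun s : ℝ => ρ t (0 + s • z)) _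
    (zero_lt_one (α := ℝ))
    (fun s _ =>
      (hasDerivAt_line (differentiable_of_smooth hsm) 0 z s).continuousAt.continuousWithinAt)
    (fun s _ => hasDerivAt_line (differentiable_of_smooth hsm) 0 z s)
  simp only [zero_add, one_smul, zero_smul, sub_zero, div_one] at h1
  set N := 1 + ‖z‖ ^ 2 with hN
  have hN0 : 0 ≤ N := by positivity
  have h2 := (le_abs_self _).trans (abs_fderiv_le_gradNorm (ρ t) (s • z) z)
  have hz1 := norm_fst_le z
  have hz2 := norm_snd_le z
  have h3 : √(‖z.1‖ ^ 2 + ‖z.2‖ ^ 2) ≤ 2 * ‖z‖ := by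
    rw [Real.sqrt_le_left (by positivity)]
    nlinarith [norm_nonneg z.1, norm_nonneg z.2, norm_nonneg z]
  have hsz : ‖s • z‖ ≤ ‖z‖ := by
    rw [norm_smul, Real.norm_of_nonneg hs.1.le]
    exact mul_le_of_le_one_left (norm_nonneg _) hs.2.le
  have h4 : √(gradNormSq (ρ t) (s • z)) ≤ a₀ * exp (C * N) * (2 * ‖z‖) := by
    refine (hgrow t (hsub t ht) _).trans ?_
    have h5 : w (s • z) ≤ C * N := (hw _).trans (by rw [hN]; gcongr)
    have h6 : ‖(s • z).1‖ + ‖(s • z).2‖ ≤ 2 * ‖z‖ := by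
      linarith [norm_fst_le (s • z), norm_snd_le (s • z)]
    gcongr
  have h5 : ρ t z ≤ (|M| + 4 * a₀) * N * exp (C * N) := by
    have h6 : ρ t 0 ≤ |M| := (hM ⟨t, ht, rfl⟩).trans (le_abs_self M)
    have h7 := mul_le_mul h4 h3 (Real.sqrt_nonneg _) (by positivity)
    have h8 : (1 : ℝ) ≤ exp (C * N) := one_le_exp (by positivity)
    have h9 : |M| * 1 ≤ |M| * (N * exp (C * N)) := by
      gcongr
      exact one_le_mul_of_one_le_of_one_le (by rw [hN]; nlinarith [sq_nonneg ‖z‖]) h8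
    have h10 : a₀ * exp (C * N) * ‖z‖ ^ 2 ≤ a₀ * exp (C * N) * N := by
      gcongr
      rw [hN]
      linarith
    nlinarith
  calc exp (w z) * ρ t z ≤ exp (w z) * ((|M| + 4 * a₀) * N * exp (C * N)) := by gcongr
    _ ≤ exp (C * N) * (exp ((|M| + 4 * a₀) * N) * exp (C * N)) := by
        have h6 := add_one_le_exp ((|M| + 4 * a₀) * N)
        have h7 : (|M| + 4 * a₀) * N ≤ exp ((|M| + 4 * a₀) * N) := by linarith
        have := hw z
        gcongr
    _ = exp ((C + (|M| + 4 * a₀ + C)) * N) := by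
        rw [← exp_add, ← exp_add]
        ring_nf

end GroundState

section HarnackForm
open Filter Topology

variable {n : ℕ}

/-- The quadratic form of the Harnack matrix. -/
def harnackForm (k t : ℝ) (ζ : E n × E n) : ℝ :=
  harnackXX k t * ‖ζ.1‖ ^ 2 + 2 * harnackXV k t * inner ℝ ζ.1 ζ.2 + harnackVV k t * ‖ζ.2‖ ^ 2

/-- The optimal control associated with `harnackForm`. -/
def harnackControl (k t : ℝ) (ζ : E n × E n) : E n :=
  -(harnackXV k t • ζ.1 + harnackVV k t • ζ.2)

theorem harnackForm_smul (k t s : ℝ) (ζ : E n × E n) :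
    harnackForm k t (s • ζ) = s ^ 2 * harnackForm k t ζ := by
  simp only [harnackForm, Prod.smul_fst, Prod.smul_snd, norm_smul, real_inner_smul_left,
    real_inner_smul_right, mul_pow, Real.norm_eq_abs, sq_abs]
  ring

theorem norm_sq_le_add_sq (z : E n × E n) : ‖z‖ ^ 2 ≤ ‖z.1‖ ^ 2 + ‖z.2‖ ^ 2 := by
  rw [Prod.norm_def]
  rcases max_choice ‖z.1‖ ‖z.2‖ with h | h <;> rw [h] <;>
    nlinarith [sq_nonneg ‖z.1‖, sq_nonneg ‖z.2‖]

theorem exists_harnackForm_le {k T : ℝ} (hk : 0 < k) (hT : 0 < T) :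
    ∃ c > 0, ∀ t ∈ Ioc 0 T, ∀ ζ : E n × E n, harnackForm k t ζ ≤ -(c / t * ‖ζ‖ ^ 2) := by
  obtain ⟨c, hc, h⟩ := harnack_form_le hk hT
  refine ⟨c, hc, fun t ht ζ => ?_⟩
  have h1 := h t ht (‖ζ.1‖ ^ 2) (inner ℝ ζ.1 ζ.2) (‖ζ.2‖ ^ 2) (by positivity) (by positivity) (by
    rw [← mul_pow]
    exact sq_le_sq' (abs_le.1 (abs_real_inner_le_norm _ _)).1
      (abs_le.1 (abs_real_inner_le_norm _ _)).2)
  have h2 := norm_sq_le_add_sq ζ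
  have h3 : 0 ≤ c / t := div_nonneg hc.le ht.1.le
  rw [harnackForm]
  nlinarith [mul_le_mul_of_nonneg_left h2 h3]

theorem hasDerivAt_affine {V : Type*} [NormedAddCommGroup V] [NormedSpace ℝ V] (p d : V) (t : ℝ) :
    HasDerivAt (fun τ : ℝ => p + (τ - t) • d) d t := by
  simpa using (((hasDerivAt_id t).sub_const t).smul_const d).const_add p

theorem hasDerivAt_harnackForm {k t t₀ : ℝ} (hk : 0 < k) (ht : t₀ < t) (ζ : E n × E n) :
    HasDerivAt (fun τ => harnackForm k (τ - t₀)
        (ζ + (τ - t) • ((ζ.2, (2 : ℝ) • harnackControl k (t - t₀) ζ) : E n × E n)))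
      (-(k * ‖ζ.2‖ ^ 2) - 2 * ‖harnackControl k (t - t₀) ζ‖ ^ 2) t := by
  have ht' := sub_pos.2 ht
  set β := harnackControl k (t - t₀) ζ with hβ
  have h1 := hasDerivAt_affine ζ.1 ζ.2 t
  have h2 := hasDerivAt_affine ζ.2 ((2 : ℝ) • β) t
  have hX := (hasDerivAt_harnackXX hk ht').comp_sub_const t t₀
  have hP := (hasDerivAt_harnackXV hk ht').comp_sub_const t t₀
  have hY := (hasDerivAt_harnackVV hk ht').comp_sub_const t t₀
  have h := ((hX.mul h1.norm_sq).add ((hP.const_mul 2).mul (h1.inner ℝ h2))).add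
    (hY.mul h2.norm_sq)
  refine h.congr_deriv ?_
  simp only [sub_self, zero_smul, add_zero, hβ, harnackControl, inner_smul_right, inner_neg_right,
    inner_add_right, norm_neg, norm_add_sq_real, norm_smul, mul_pow, Real.norm_eq_abs, sq_abs,
    real_inner_smul_left, real_inner_self_eq_norm_sq]
  rw [real_inner_comm ζ.2 ζ.1]
  ring

/-- A Gaussian-type weight. -/
def barrier (B : ℝ) (z : E n × E n) : ℝ := exp (B * (1 + ‖z.1‖ ^ 2 + ‖z.2‖ ^ 2))

theorem barrier_pos (B : ℝ) (z : E n × E n) : 0 < barrier B z := exp_pos _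

theorem barrier_add_smul (B : ℝ) (z : E n × E n) (i : Fin n) (s : ℝ) :
    barrier B (z + s • stdBasis n (Sum.inr i)) =
      exp (B * (1 + ‖z.1‖ ^ 2 + ‖z.2‖ ^ 2 + 2 * z.2 i * s + s ^ 2)) := by
  rw [barrier]
  simp only [_root_.stdBasis, Prod.fst_add, Prod.snd_add, Prod.smul_fst, Prod.smul_snd, smul_zero,
    add_zero, norm_add_sq_real, real_inner_smul_right, inner_single_right, norm_smul,
    norm_single_one, mul_one, Real.norm_eq_abs, sq_abs]
  ring_nf

theorem hasDerivAt_exp_quadratic (B N y s : ℝ) :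
    HasDerivAt (fun s => exp (B * (N + 2 * y * s + s ^ 2)))
      (B * (2 * y + 2 * s) * exp (B * (N + 2 * y * s + s ^ 2))) s := by
  have h := ((((hasDerivAt_id s).const_mul (2 * y)).const_add N).add
    (hasDerivAt_pow 2 s)).const_mul B
  refine h.exp.congr_deriv ?_
  simp
  ring

theorem hasDerivAt_deriv_exp_quadratic (B N y : ℝ) :
    HasDerivAt (fun s => B * (2 * y + 2 * s) * exp (B * (N + 2 * y * s + s ^ 2)))
      ((2 * B + 4 * B ^ 2 * y ^ 2) * exp (B * N)) 0 := by
  have h := ((((hasDerivAt_id (0 : ℝ)).const_mul 2).const_add (2 * y)).const_mul B).mul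
    (hasDerivAt_exp_quadratic B N y 0)
  refine h.congr_deriv ?_
  simp
  ring

theorem hasDerivAt_barrier {B : ℝ → ℝ} {B' t : ℝ} (hB : HasDerivAt B B' t) (z : E n × E n) :
    HasDerivAt (fun τ => barrier (B τ) (z + (τ - t) • ((z.2, 0) : E n × E n)))
      ((B' * (1 + ‖z.1‖ ^ 2 + ‖z.2‖ ^ 2) + 2 * B t * inner ℝ z.1 z.2) * barrier (B t) z) t := by
  have h1 := hasDerivAt_affine z.1 z.2 t
  have h2 := hasDerivAt_affine z.2 (0 : E n) t
  have h := (hB.mul ((h1.norm_sq.const_add 1).add h2.norm_sq)).exp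
  refine h.congr_deriv ?_
  simp [barrier]
  ring

theorem velocity_eq_sum (g : E n × E n → ℝ) (z : E n × E n) (y : E n) :
    fderiv ℝ g z (0, y) = ∑ i, y i * fderiv ℝ g z (stdBasis n (Sum.inr i)) := by
  rw [fderiv_eq_sum_pd]
  simp [Fintype.sum_sum_type, coords, pd]

theorem hasDerivAt_exp_mul_line {g : E n × E n → ℝ} (hg : Differentiable ℝ g) (z e : E n × E n)
    (l a s : ℝ) :
    HasDerivAt (fun s => exp (l + a * s) * g (z + s • e))
      (exp (l + a * s) * (a * g (z + s • e) + fderiv ℝ g (z + s • e) e)) s := by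
  have h := ((((hasDerivAt_id s).const_mul a).const_add l).exp).mul (hasDerivAt_line hg z e s)
  refine h.congr_deriv ?_
  simp
  ring

theorem hasDerivAt_deriv_exp_mul_line {g : E n × E n → ℝ} (hg : ContDiff ℝ (⊤ : ℕ∞) g)
    (z e : E n × E n) (l a : ℝ) :
    HasDerivAt (fun s => exp (l + a * s) * (a * g (z + s • e) + fderiv ℝ g (z + s • e) e))
      (exp l * (a ^ 2 * g z + 2 * (a * fderiv ℝ g z e) + dirDeriv2 g e z)) 0 := by
  have h := ((((hasDerivAt_id (0 : ℝ)).const_mul a).const_add l).exp).mul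
    (((hasDerivAt_line (differentiable_of_smooth hg) z e 0).const_mul a).add
      (hasDerivAt_line2 hg z e 0))
  refine h.congr_deriv ?_
  simp
  ring

theorem hasDerivAt_along_flow {T : ℝ} {f : ℝ → E n × E n → ℝ} {h : E n × E n → ℝ}
    (hf : ContDiffOn ℝ (⊤ : ℕ∞) (fun q : ℝ × (E n × E n) => f q.1 q.2) (Ioo 0 T ×ˢ univ))
    (hpde : ∀ t ∈ Ioo 0 T, ∀ z, deriv (fun τ => f τ z) t =
      lapV (f t) z - fderiv ℝ (f t) z (z.2, 0) + h z * f t z)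
    {t : ℝ} (ht : t ∈ Ioo 0 T) {γ : ℝ → E n × E n} {p : E n × E n} {β : E n} (hp : γ t = p)
    (hγ : HasDerivAt γ (p.2, β) t) :
    HasDerivAt (fun τ => f τ (γ τ)) (lapV (f t) p + h p * f t p + fderiv ℝ (f t) p (0, β)) t := by
  refine (hasDerivAt_curve hf ht hγ).congr_deriv ?_
  have h1 : ((p.2, β) : E n × E n) = (p.2, 0) + (0, β) := by simp
  rw [hp, hpde t ht, h1, map_add]
  ring

end HarnackForm

section Comparison
open Filter Topology

variable {n : ℕ}

/-- The two-point comparison function whose positivity encodes the Harnack inequality; `p.1` is the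
base point, `p.2.1` the displacement and `p.2.2` the tilt. -/
def comparisonGap (f : ℝ → E n × E n → ℝ) (k t₀ ε : ℝ) (B : ℝ → ℝ) (t : ℝ)
    (p : (E n × E n) × (E n × E n) × ℝ) : ℝ :=
  exp p.2.2 * f t (p.1 + p.2.1) + exp (-p.2.2) * f t (p.1 - p.2.1) + ε * barrier (B t) p.1
    - 2 * f t p.1 * exp (harnackForm k (t - t₀) p.2.1 / 2)

variable {T k t₀ : ℝ} {f : ℝ → E n × E n → ℝ} {h : E n × E n → ℝ}

theorem comparisonGap_second_order
    (hf : ContDiffOn ℝ (⊤ : ℕ∞) (fun q : ℝ × (E n × E n) => f q.1 q.2) (Ioo 0 T ×ˢ univ))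
    {t ε : ℝ} {B : ℝ → ℝ} (ht : t ∈ Ioo 0 T) (z ζ : E n × E n) (l : ℝ) (α : E n)
    (hz : comparisonGap f k t₀ ε B t (z, ζ, l) = 0)
    (hle : ∀ p, 0 ≤ comparisonGap f k t₀ ε B t p) :
    0 ≤ exp l * (‖α‖ ^ 2 * f t (z + ζ) + 2 * fderiv ℝ (f t) (z + ζ) (0, α) + lapV (f t) (z + ζ))
      + exp (-l) * (‖α‖ ^ 2 * f t (z - ζ) - 2 * fderiv ℝ (f t) (z - ζ) (0, α) + lapV (f t) (z - ζ))
      + ε * ((2 * n * B t + 4 * B t ^ 2 * ‖z.2‖ ^ 2) * barrier (B t) z)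
      - 2 * exp (harnackForm k (t - t₀) ζ / 2) * lapV (f t) z := by
  have hsm := contDiff_slice hf ht
  have hdf := differentiable_of_smooth hsm
  have hi : ∀ i : Fin n, 0 ≤
      exp l * ((α i) ^ 2 * f t (z + ζ) + 2 * (α i * fderiv ℝ (f t) (z + ζ) (stdBasis n (Sum.inr i)))
        + dirDeriv2 (f t) (stdBasis n (Sum.inr i)) (z + ζ))
      + exp (-l) * ((-α i) ^ 2 * f t (z - ζ)
        + 2 * (-α i * fderiv ℝ (f t) (z - ζ) (stdBasis n (Sum.inr i)))
        + dirDeriv2 (f t) (stdBasis n (Sum.inr i)) (z - ζ))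
      + ε * ((2 * B t + 4 * B t ^ 2 * (z.2 i) ^ 2) * exp (B t * (1 + ‖z.1‖ ^ 2 + ‖z.2‖ ^ 2)))
      - 2 * exp (harnackForm k (t - t₀) ζ / 2) * dirDeriv2 (f t) (stdBasis n (Sum.inr i)) z := by
    intro i
    set e := stdBasis n (Sum.inr i) with he
    set Eq := exp (harnackForm k (t - t₀) ζ / 2) with hEq
    set N := 1 + ‖z.1‖ ^ 2 + ‖z.2‖ ^ 2 with hN
    have hmin : IsLocalMin (fun s : ℝ => exp (l + α i * s) * f t (z + ζ + s • e)
        + exp (-l + -α i * s) * f t (z - ζ + s • e)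
        + ε * exp (B t * (N + 2 * z.2 i * s + s ^ 2)) - 2 * Eq * f t (z + s • e)) 0 := by
      have hline : ∀ s : ℝ, exp (l + α i * s) * f t (z + ζ + s • e)
        + exp (-l + -α i * s) * f t (z - ζ + s • e)
        + ε * exp (B t * (N + 2 * z.2 i * s + s ^ 2)) - 2 * Eq * f t (z + s • e) =
          comparisonGap f k t₀ ε B t (z + s • e, ζ, l + α i * s) := by
        intro s
        rw [comparisonGap, he, hN, ← barrier_add_smul, ← he, add_right_comm z ζ, sub_add_eq_add_sub,
          neg_add, neg_mul]
        ring
      refine Eventually.of_forall fun s => ?_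
      simp only [hline]
      rw [zero_smul, add_zero, mul_zero, add_zero, hz]
      exact hle _
    have h2 := second_deriv_nonneg_of_isLocalMin hmin
      (Eventually.of_forall fun s => (((hasDerivAt_exp_mul_line hdf (z + ζ) e l (α i) s).add
        (hasDerivAt_exp_mul_line hdf (z - ζ) e (-l) (-α i) s)).add
        ((hasDerivAt_exp_quadratic (B t) N (z.2 i) s).const_mul ε)).sub
        ((hasDerivAt_line hdf z e s).const_mul (2 * Eq)))
      ((((hasDerivAt_deriv_exp_mul_line hsm (z + ζ) e l (α i)).add
        (hasDerivAt_deriv_exp_mul_line hsm (z - ζ) e (-l) (-α i))).add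
        ((hasDerivAt_deriv_exp_quadratic (B t) N (z.2 i)).const_mul ε)).sub
        ((hasDerivAt_line2 hsm z e 0).const_mul (2 * Eq)))
    rwa [zero_smul, add_zero] at h2
  refine (Finset.sum_nonneg (s := Finset.univ) fun i _ => hi i).trans_eq ?_
  simp only [lapV_eq_sum, velocity_eq_sum, EuclideanSpace.real_norm_sq_eq α,
    EuclideanSpace.real_norm_sq_eq z.2, barrier]
  simp only [Finset.sum_add_distrib, Finset.sum_sub_distrib, ← Finset.sum_mul, ← Finset.mul_sum,
    neg_mul, Finset.sum_neg_distrib, neg_sq, Finset.sum_const, Finset.card_univ, Fintype.card_fin,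
    nsmul_eq_mul]
  ring

theorem hasDerivAt_comparisonGap
    (hf : ContDiffOn ℝ (⊤ : ℕ∞) (fun q : ℝ × (E n × E n) => f q.1 q.2) (Ioo 0 T ×ˢ univ))
    (hpde : ∀ t ∈ Ioo 0 T, ∀ z, deriv (fun τ => f τ z) t =
      lapV (f t) z - fderiv ℝ (f t) z (z.2, 0) + h z * f t z)
    (hk : 0 < k) {t ε B' : ℝ} {B : ℝ → ℝ} (hB : HasDerivAt B B' t) (ht : t ∈ Ioo 0 T)
    (ht₀ : t₀ < t) (z ζ : E n × E n) (l r : ℝ) {α : E n}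
    (hα : α = harnackControl k (t - t₀) ζ) :
    HasDerivAt (fun τ => comparisonGap f k t₀ ε B τ (z + (τ - t) • (z.2, 0),
        ζ + (τ - t) • (ζ.2, (2 : ℝ) • α), l + (τ - t) • (-r)))
      (exp l * (lapV (f t) (z + ζ) + 2 * fderiv ℝ (f t) (z + ζ) (0, α)
          + (h (z + ζ) - r) * f t (z + ζ))
        + exp (-l) * (lapV (f t) (z - ζ) - 2 * fderiv ℝ (f t) (z - ζ) (0, α)
          + (h (z - ζ) + r) * f t (z - ζ))
        + ε * ((B' * (1 + ‖z.1‖ ^ 2 + ‖z.2‖ ^ 2) + 2 * B t * inner ℝ z.1 z.2) * barrier (B t) z)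
        - 2 * exp (harnackForm k (t - t₀) ζ / 2) * (lapV (f t) z
          + (h z - k * ‖ζ.2‖ ^ 2 / 2 - ‖α‖ ^ 2) * f t z)) t := by
  have hl := hasDerivAt_affine l (-r) t
  have hz := hasDerivAt_affine z ((z.2, 0) : E n × E n) t
  have hζ := hasDerivAt_affine ζ ((ζ.2, (2 : ℝ) • α) : E n × E n) t
  have hplus := hasDerivAt_along_flow hf hpde ht (p := z + ζ) (β := (2 : ℝ) • α)
    (γ := fun τ => (z + (τ - t) • (z.2, 0)) + (ζ + (τ - t) • (ζ.2, (2 : ℝ) • α)))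
    (by simp only [sub_self, zero_smul, add_zero])
    ((hz.add hζ).congr_deriv (by simp))
  have hminus := hasDerivAt_along_flow hf hpde ht (p := z - ζ) (β := -((2 : ℝ) • α))
    (γ := fun τ => (z + (τ - t) • (z.2, 0)) - (ζ + (τ - t) • (ζ.2, (2 : ℝ) • α)))
    (by simp only [sub_self, zero_smul, add_zero])
    ((hz.sub hζ).congr_deriv (by simp))
  have hbase := hasDerivAt_along_flow hf hpde ht (p := z) (β := 0)
    (γ := fun τ => z + (τ - t) • (z.2, 0)) (by simp only [sub_self, zero_smul, add_zero]) hz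
  have hq := hasDerivAt_harnackForm hk ht₀ ζ
  rw [← hα] at hq
  have h1 := (((hl.exp.mul hplus).add (hl.neg.exp.mul hminus)).add
    ((hasDerivAt_barrier hB z).const_mul ε)).sub ((hbase.const_mul 2).mul (hq.div_const 2).exp)
  refine h1.congr_deriv ?_
  have h2 : ((0, (2 : ℝ) • α) : E n × E n) = (2 : ℝ) • (0, α) := by simp
  have h3 : ((0, -((2 : ℝ) • α)) : E n × E n) = (-2 : ℝ) • (0, α) := by simp
  have h4 : ((0, 0) : E n × E n) = 0 := rfl
  rw [h2, h3, h4, map_smul, map_smul, map_zero]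
  simp only [Pi.neg_apply, sub_self, zero_smul, add_zero, smul_eq_mul]
  ring_nf

theorem comparisonGap_not_touch
    (hf : ContDiffOn ℝ (⊤ : ℕ∞) (fun q : ℝ × (E n × E n) => f q.1 q.2) (Ioo 0 T ×ˢ univ))
    (hpos : ∀ t ∈ Ioo 0 T, ∀ z, 0 < f t z)
    (hpde : ∀ t ∈ Ioo 0 T, ∀ z, deriv (fun τ => f τ z) t =
      lapV (f t) z - fderiv ℝ (f t) z (z.2, 0) + h z * f t z)
    (hk : 0 < k) (hh : ∀ z ζ, h z + fderiv ℝ h z ζ - k * ‖ζ.2‖ ^ 2 / 2 ≤ h (z + ζ))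
    {t a ε B' : ℝ} {B : ℝ → ℝ} (hε : 0 < ε) (hB : HasDerivAt B B' t) (ht : t ∈ Ioo 0 T)
    (ht₀ : t₀ < t) (hat : a < t)
    (hB' : ∀ z : E n × E n, 2 * n * B t + 4 * B t ^ 2 * ‖z.2‖ ^ 2 + h z <
      B' * (1 + ‖z.1‖ ^ 2 + ‖z.2‖ ^ 2) + 2 * B t * inner ℝ z.1 z.2)
    (p : (E n × E n) × (E n × E n) × ℝ) (hp : comparisonGap f k t₀ ε B t p = 0)
    (hle : ∀ s ∈ Icc a t, ∀ p, 0 ≤ comparisonGap f k t₀ ε B s p) : False := by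
  obtain ⟨z, ζ, l⟩ := p
  set α := harnackControl k (t - t₀) ζ with hα
  have h1 := comparisonGap_second_order hf ht z ζ l α hp (hle t ⟨hat.le, le_rfl⟩)
  have h2 := deriv_nonpos_of_nonneg_left hat (fun s hs => hle s hs _) (by simpa using hp)
    (hasDerivAt_comparisonGap (ε := ε) hf hpde hk hB ht ht₀ z ζ l (fderiv ℝ h z ζ) hα)
  have h3 := mul_le_mul_of_nonneg_right (hh z ζ) (mul_pos (exp_pos l) (hpos t ht (z + ζ))).le
  have h4 := mul_le_mul_of_nonneg_right (hh z (-ζ))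
    (mul_pos (exp_pos (-l)) (hpos t ht (z - ζ))).le
  rw [map_neg, Prod.snd_neg, norm_neg, ← sub_eq_add_neg, ← sub_eq_add_neg] at h4
  simp only [comparisonGap] at hp
  have h5 := mul_lt_mul_of_pos_right (hB' z) (mul_pos hε (barrier_pos (B t) z))
  have h6 : (h z - k * ‖ζ.2‖ ^ 2 / 2 - ‖α‖ ^ 2) * (exp l * f t (z + ζ) + exp (-l) * f t (z - ζ)
      + ε * barrier (B t) z - 2 * f t z * exp (harnackForm k (t - t₀) ζ / 2)) = 0 := by
    rw [hp, mul_zero]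
  have h7 : 0 ≤ (k * ‖ζ.2‖ ^ 2 / 2 + ‖α‖ ^ 2) * (ε * barrier (B t) z) :=
    mul_nonneg (by positivity) (mul_pos hε (barrier_pos (B t) z)).le
  linarith

end Comparison

section BarrierBounds
open Filter Topology Metric

variable {n : ℕ} {T k t₀ : ℝ} {f : ℝ → E n × E n → ℝ} {h : E n × E n → ℝ}

/-- The Riccati rate at which the exponent of the barrier has to grow. -/
theorem barrier_rate_lt {C : ℝ} (hC : 0 ≤ C) (hup : ∀ z, h z ≤ C * (1 + ‖z‖ ^ 2)) {B : ℝ}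
    (hB : 1 ≤ B) (z : E n × E n) :
    2 * n * B + 4 * B ^ 2 * ‖z.2‖ ^ 2 + h z <
      (2 * n + 6 + C) * B ^ 2 * (1 + ‖z.1‖ ^ 2 + ‖z.2‖ ^ 2) + 2 * B * inner ℝ z.1 z.2 := by
  have h1 := norm_sq_le_add_sq z
  have h2 := (abs_le.1 (abs_real_inner_le_norm z.1 z.2)).1
  have h3 := hup z
  set N := 1 + ‖z.1‖ ^ 2 + ‖z.2‖ ^ 2 with hN
  have hN1 : 1 ≤ N := by rw [hN]; nlinarith [sq_nonneg ‖z.1‖, sq_nonneg ‖z.2‖]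
  have hBB : B ≤ B ^ 2 := by nlinarith
  have h4 : h z ≤ C * N := h3.trans (mul_le_mul_of_nonneg_left (by linarith) hC)
  have h5 : -N ≤ 2 * inner ℝ z.1 z.2 := by nlinarith [sq_nonneg (‖z.1‖ - ‖z.2‖)]
  have h6 : C * N ≤ C * N * B ^ 2 := le_mul_of_one_le_right (by positivity) (by linarith)
  have h7 : (n : ℝ) * B ≤ n * (B ^ 2 * N) :=
    mul_le_mul_of_nonneg_left (hBB.trans (le_mul_of_one_le_right (by positivity) hN1))
      (Nat.cast_nonneg n)
  have h8 : B * -N ≤ B * (2 * inner ℝ z.1 z.2) := mul_le_mul_of_nonneg_left h5 (by linarith)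
  have h9 : B * N ≤ B ^ 2 * N := mul_le_mul_of_nonneg_right hBB (by linarith)
  have h10 : B ^ 2 * ‖z.2‖ ^ 2 ≤ B ^ 2 * N :=
    mul_le_mul_of_nonneg_left (by rw [hN]; nlinarith [sq_nonneg ‖z.1‖]) (by positivity)
  have h11 : 0 < B ^ 2 * N := by positivity
  linarith

theorem comparisonGap_nonpos_bounds {K t ε : ℝ} {B : ℝ → ℝ} (hK : 0 ≤ K) (hε : 0 < ε)
    (hpos : ∀ z, 0 < f t z) (hbd : ∀ z, f t z ≤ exp (K * (1 + ‖z‖ ^ 2))) (hB : K + 1 ≤ B t)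
    {z ζ : E n × E n} {l : ℝ} (hq : harnackForm k (t - t₀) ζ ≤ 0)
    (hgap : comparisonGap f k t₀ ε B t (z, ζ, l) ≤ 0) :
    1 + ‖z‖ ^ 2 ≤ 2 / ε ∧ -harnackForm k (t - t₀) ζ ≤ 4 * exp (2 * K / ε) / ε ∧
      exp l * f t (z + ζ) ≤ 2 * exp (2 * K / ε) ∧ exp (-l) * f t (z - ζ) ≤ 2 * exp (2 * K / ε) := by
  simp only [comparisonGap] at hgap
  set q := harnackForm k (t - t₀) ζ
  have hp := mul_pos (exp_pos l) (hpos (z + ζ))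
  have hm := mul_pos (exp_pos (-l)) (hpos (z - ζ))
  have hΨ : exp ((K + 1) * (1 + ‖z‖ ^ 2)) ≤ barrier (B t) z := by
    refine exp_le_exp.2 (mul_le_mul hB ?_ (by positivity) (by linarith))
    linarith [norm_sq_le_add_sq z]
  have hεΨ := mul_le_mul_of_nonneg_left hΨ hε.le
  have he1 : exp (q / 2) ≤ 1 := exp_le_one_iff.2 (by linarith)
  have hfe : f t z * exp (q / 2) ≤ f t z := mul_le_of_le_one_right (hpos z).le he1
  have hz : 1 + ‖z‖ ^ 2 ≤ 2 / ε := by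
    rw [le_div_iff₀ hε]
    have h1 : (1 + ‖z‖ ^ 2) * exp (K * (1 + ‖z‖ ^ 2)) ≤ exp ((K + 1) * (1 + ‖z‖ ^ 2)) := by
      rw [add_mul K, one_mul, exp_add, mul_comm (1 + ‖z‖ ^ 2)]
      exact mul_le_mul_of_nonneg_left (by linarith [add_one_le_exp (1 + ‖z‖ ^ 2)]) (exp_pos _).le
    have h2 := mul_le_mul_of_nonneg_left h1 hε.le
    have h3 := hbd z
    refine le_of_mul_le_mul_right ?_ (exp_pos (K * (1 + ‖z‖ ^ 2)))
    linarith
  have hfM : f t z ≤ exp (2 * K / ε) := by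
    refine (hbd z).trans (exp_le_exp.2 ?_)
    rw [mul_comm 2 K, mul_div_assoc]
    exact mul_le_mul_of_nonneg_left hz hK
  have hΨpos := mul_pos hε (barrier_pos (B t) z)
  refine ⟨hz, ?_, by linarith, by linarith⟩
  have h1 : ε ≤ 2 * exp (2 * K / ε) * exp (q / 2) := by
    have h2 : 1 ≤ exp ((K + 1) * (1 + ‖z‖ ^ 2)) := one_le_exp (by positivity)
    have h3 := mul_le_mul_of_nonneg_left h2 hε.le
    have h4 := mul_le_mul_of_nonneg_right hfM (exp_pos (q / 2)).le
    linarith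
  have h2 : ε * (-q / 2) ≤ ε * exp (-q / 2) :=
    mul_le_mul_of_nonneg_left (by linarith [add_one_le_exp (-q / 2)]) hε.le
  have h3 := mul_le_mul_of_nonneg_right h1 (exp_pos (-q / 2)).le
  rw [mul_assoc (2 * _), ← exp_add, neg_div, add_neg_cancel, exp_zero, ← neg_div] at h3
  rw [le_div_iff₀ hε]
  linarith

theorem norm_sq_le_of_harnackForm {c s A : ℝ} (hc : 0 < c) (hs : 0 < s) {ζ : E n × E n}
    (h1 : harnackForm k s ζ ≤ -(c / s * ‖ζ‖ ^ 2)) (h2 : -harnackForm k s ζ ≤ A) :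
    ‖ζ‖ ^ 2 ≤ s * (A / c) := by
  have h3 : c / s * ‖ζ‖ ^ 2 ≤ A := by linarith
  rw [div_mul_eq_mul_div, div_le_iff₀ hs] at h3
  rw [mul_div_assoc', le_div_iff₀ hc]
  linarith

theorem abs_le_of_exp_mul_le {l u w μ A : ℝ} (hμ : 0 < μ) (hu : μ ≤ u) (hw : μ ≤ w)
    (h1 : exp l * u ≤ A) (h2 : exp (-l) * w ≤ A) : |l| ≤ A / μ := by
  have h3 := mul_le_mul_of_nonneg_left hu (exp_pos l).le
  have h4 := mul_le_mul_of_nonneg_left hw (exp_pos (-l)).le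
  have h5 := mul_le_mul_of_nonneg_right (add_one_le_exp l) hμ.le
  have h6 := mul_le_mul_of_nonneg_right (add_one_le_exp (-l)) hμ.le
  rw [abs_le, ← neg_div, div_le_iff₀ hμ, le_div_iff₀ hμ]
  constructor <;> linarith

theorem continuousOn_comparisonGap
    (hf : ContDiffOn ℝ (⊤ : ℕ∞) (fun q : ℝ × (E n × E n) => f q.1 q.2) (Ioo 0 T ×ˢ univ))
    (hk : 0 < k) {a b : ℝ} (ha : 0 < a) (hb : b < T) (hat : t₀ < a) (ε : ℝ) {B : ℝ → ℝ}
    (hB : ContinuousOn B (Icc a b)) :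
    ContinuousOn (fun q : ℝ × ((E n × E n) × (E n × E n) × ℝ) =>
      comparisonGap f k t₀ ε B q.1 q.2) (Icc a b ×ˢ univ) := by
  have hcoef : ∀ {φ : ℝ → ℝ} {φ' : ℝ → ℝ}, (∀ s, 0 < s → HasDerivAt φ (φ' s) s) →
      ContinuousOn (fun q : ℝ × ((E n × E n) × (E n × E n) × ℝ) => φ (q.1 - t₀))
        (Icc a b ×ˢ univ) := fun hφ q hq =>
    ((hφ _ (by linarith [hq.1.1])).continuousAt.comp (f := fun q : ℝ × _ => q.1 - t₀)
      (by fun_prop)).continuousWithinAt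
  have hX := hcoef fun s hs => hasDerivAt_harnackXX hk hs
  have hP := hcoef fun s hs => hasDerivAt_harnackXV hk hs
  have hY := hcoef fun s hs => hasDerivAt_harnackVV hk hs
  have hBc : ContinuousOn (fun q : ℝ × ((E n × E n) × (E n × E n) × ℝ) => B q.1)
      (Icc a b ×ˢ univ) := hB.comp continuousOn_fst fun q hq => hq.1
  have hfc : ∀ {g : ℝ × ((E n × E n) × (E n × E n) × ℝ) → E n × E n}, Continuous g →
      ContinuousOn (fun q => f q.1 (g q)) (Icc a b ×ˢ univ) := fun {g} hg =>
    hf.continuousOn.comp (s := Icc a b ×ˢ univ) (f := fun q => (q.1, g q))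
      (continuous_fst.prodMk hg).continuousOn
      fun q hq => ⟨⟨ha.trans_le hq.1.1, hq.1.2.trans_lt hb⟩, mem_univ _⟩
  have h1 := hfc (g := fun q => q.2.1 + q.2.2.1) (by fun_prop)
  have h2 := hfc (g := fun q => q.2.1 - q.2.2.1) (by fun_prop)
  have h3 := hfc (g := fun q => q.2.1) (by fun_prop)
  have hn : ∀ {V : Type} [NormedAddCommGroup V] {g : ℝ × ((E n × E n) × (E n × E n) × ℝ) → V},
      Continuous g → ContinuousOn (fun q => ‖g q‖ ^ 2) (Icc a b ×ˢ univ) := fun hg =>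
    (hg.norm.pow 2).continuousOn
  have he : ContinuousOn (fun q : ℝ × ((E n × E n) × (E n × E n) × ℝ) => exp q.2.2.2)
      (Icc a b ×ˢ univ) := by fun_prop
  have he' : ContinuousOn (fun q : ℝ × ((E n × E n) × (E n × E n) × ℝ) => exp (-q.2.2.2))
      (Icc a b ×ˢ univ) := by fun_prop
  have hform : ContinuousOn (fun q : ℝ × ((E n × E n) × (E n × E n) × ℝ) =>
      harnackForm k (q.1 - t₀) q.2.2.1) (Icc a b ×ˢ univ) :=
    ((hX.mul (hn (g := fun q => q.2.2.1.1) (by fun_prop))).add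
      ((continuousOn_const.mul hP).mul (Continuous.continuousOn (by fun_prop)))).add
      (hY.mul (hn (g := fun q => q.2.2.1.2) (by fun_prop)))
  exact (((he.mul h1).add (he'.mul h2)).add (continuousOn_const.mul (hBc.mul
    ((continuousOn_const.add (hn (g := fun q => q.2.1.1) (by fun_prop))).add
      (hn (g := fun q => q.2.1.2) (by fun_prop)))).rexp)).sub
    ((continuousOn_const.mul h3).mul (hform.div_const 2).rexp)

theorem exists_isCompact_comparisonGap_nonpos
    (hf : ContDiffOn ℝ (⊤ : ℕ∞) (fun q : ℝ × (E n × E n) => f q.1 q.2) (Ioo 0 T ×ˢ univ))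
    (hpos : ∀ t ∈ Ioo 0 T, ∀ z, 0 < f t z) (hk : 0 < k) {a b K ε : ℝ} {B : ℝ → ℝ} (ha : 0 < a)
    (hb : b < T) (ht₀ : 0 < t₀) (hat : t₀ < a) (hK : 0 ≤ K) (hε : 0 < ε)
    (hbd : ∀ t ∈ Icc a b, ∀ z, f t z ≤ exp (K * (1 + ‖z‖ ^ 2)))
    (hB : ∀ t ∈ Icc a b, K + 1 ≤ B t) :
    ∃ S : Set ((E n × E n) × (E n × E n) × ℝ), IsCompact S ∧
      ∀ t ∈ Icc a b, ∀ p, comparisonGap f k t₀ ε B t p ≤ 0 → p ∈ S := by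
  rcases lt_or_ge b a with hab | hab
  · exact ⟨∅, isCompact_empty, fun t ht => absurd (ht.1.trans ht.2) hab.not_ge⟩
  have hT : 0 < T := by linarith
  obtain ⟨c, hc, hform⟩ := exists_harnackForm_le (n := n) hk hT
  set M := exp (2 * K / ε) with hM
  set R := 2 / ε + (1 + T * (4 * M / ε / c)) with hR
  have hsub : Icc a b ⊆ Ioo 0 T := fun t ht => ⟨ha.trans_le ht.1, ht.2.trans_lt hb⟩
  obtain ⟨q₀, hq₀, hmin⟩ :=
    (isCompact_Icc.prod (isCompact_closedBall (0 : E n × E n) R)).exists_isMinOn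
    ⟨(a, 0), ⟨le_rfl, hab⟩, by simp [hR]; positivity⟩
    (hf.continuousOn.mono (prod_mono hsub (subset_univ _)))
  set μ := f q₀.1 q₀.2 with hμ
  have hμpos : 0 < μ := hpos _ (hsub hq₀.1) _
  refine ⟨closedBall 0 R ×ˢ closedBall 0 R ×ˢ Icc (-(2 * M / μ)) (2 * M / μ),
    (isCompact_closedBall _ _).prod ((isCompact_closedBall _ _).prod isCompact_Icc), ?_⟩
  rintro t ht ⟨z, ζ, l⟩ hgap
  have hts : 0 < t - t₀ := by linarith [ht.1]
  have hfm := hform (t - t₀) ⟨hts, by linarith [ht.2]⟩ ζ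
  obtain ⟨h1, h2, h3, h4⟩ := comparisonGap_nonpos_bounds hK hε (hpos t (hsub ht)) (hbd t ht)
    (hB t ht) (hfm.trans (neg_nonpos.2 (by positivity))) hgap
  have hz : ‖z‖ ≤ 2 / ε := by nlinarith [sq_nonneg (‖z‖ - 1)]
  have hζ : ‖ζ‖ ≤ 1 + T * (4 * M / ε / c) := by
    have h5 := norm_sq_le_of_harnackForm hc hts hfm h2
    have h6 : (t - t₀) * (4 * M / ε / c) ≤ T * (4 * M / ε / c) :=
      mul_le_mul_of_nonneg_right (by linarith [ht.2]) (by positivity)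
    nlinarith [sq_nonneg (‖ζ‖ - 1)]
  have hμ_le : ∀ y : E n × E n, ‖y‖ ≤ ‖z‖ + ‖ζ‖ → μ ≤ f t y := fun y hy =>
    hmin (a := (t, y)) ⟨ht, by rw [mem_closedBall_zero_iff]; linarith⟩
  have hl := abs_le.1 (abs_le_of_exp_mul_le hμpos (hμ_le _ (norm_add_le z ζ))
    (hμ_le _ (norm_sub_le z ζ)) h3 h4)
  have hε2 : 0 ≤ 2 / ε := by positivity
  refine ⟨?_, ?_, hl⟩
  · rw [mem_closedBall_zero_iff]; linarith [norm_nonneg ζ]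
  · rw [mem_closedBall_zero_iff]; linarith

end BarrierBounds

section TwoPoint
open Filter Topology Metric

variable {n : ℕ} {T k t₀ : ℝ} {f : ℝ → E n × E n → ℝ} {h : E n × E n → ℝ}

/-- The two-point form of the Harnack inequality at time `t`. -/
def TwoPointHarnack (f : ℝ → E n × E n → ℝ) (k t₀ t : ℝ) : Prop :=
  ∀ (z ζ : E n × E n) (l : ℝ), 2 * f t z * exp (harnackForm k (t - t₀) ζ / 2) ≤
    exp l * f t (z + ζ) + exp (-l) * f t (z - ζ)

theorem comparisonGap_pos_of_pos
    (hf : ContDiffOn ℝ (⊤ : ℕ∞) (fun q : ℝ × (E n × E n) => f q.1 q.2) (Ioo 0 T ×ˢ univ))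
    (hpos : ∀ t ∈ Ioo 0 T, ∀ z, 0 < f t z)
    (hpde : ∀ t ∈ Ioo 0 T, ∀ z, deriv (fun τ => f τ z) t =
      lapV (f t) z - fderiv ℝ (f t) z (z.2, 0) + h z * f t z)
    (hk : 0 < k) (hh : ∀ z ζ, h z + fderiv ℝ h z ζ - k * ‖ζ.2‖ ^ 2 / 2 ≤ h (z + ζ))
    {a b K C ε : ℝ} {B : ℝ → ℝ} (hb : b < T) (ht₀ : 0 < t₀) (hat : t₀ < a)
    (hK : 0 ≤ K) (hC : 0 ≤ C) (hε : 0 < ε) (hup : ∀ z, h z ≤ C * (1 + ‖z‖ ^ 2))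
    (hbd : ∀ t ∈ Icc a b, ∀ z, f t z ≤ exp (K * (1 + ‖z‖ ^ 2)))
    (hB : ∀ t ∈ Icc a b, K + 1 ≤ B t)
    (hB' : ∀ t ∈ Icc a b, HasDerivAt B ((2 * n + 6 + C) * B t ^ 2) t)
    (h0 : ∀ p, 0 < comparisonGap f k t₀ ε B a p) :
    ∀ t ∈ Icc a b, ∀ p, 0 < comparisonGap f k t₀ ε B t p := by
  by_contra! hex
  have ha : 0 < a := ht₀.trans hat
  obtain ⟨S, hS, hin⟩ := exists_isCompact_comparisonGap_nonpos hf hpos hk ha hb ht₀ hat hK hε hbd hB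
  obtain ⟨t, ht, p, hp, hle⟩ := exists_first_touch hS
    (continuousOn_comparisonGap hf hk ha hb hat ε
      fun t ht => (hB' t ht).continuousAt.continuousWithinAt) hin h0 hex
  have ht' : t ∈ Icc a b := ⟨ht.1.le, ht.2⟩
  exact comparisonGap_not_touch hf hpos hpde hk hh hε (hB' t ht')
    ⟨ha.trans ht.1, ht.2.trans_lt hb⟩ (hat.trans ht.1) ht.1
    (barrier_rate_lt hC hup (by linarith [hB t ht'])) p hp hle

/-- Shortly after the initial time `t₀` the comparison function is positive, because the Harnack
form degenerates to `-∞` off the diagonal. -/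
theorem exists_comparisonGap_pos_near
    (hf : ContDiffOn ℝ (⊤ : ℕ∞) (fun q : ℝ × (E n × E n) => f q.1 q.2) (Ioo 0 T ×ˢ univ))
    (hpos : ∀ t ∈ Ioo 0 T, ∀ z, 0 < f t z) (hk : 0 < k) {b K ε : ℝ} {B : ℝ → ℝ}
    (hb : b < T) (ht₀ : 0 < t₀) (htb : t₀ < b) (hK : 0 ≤ K) (hε : 0 < ε)
    (hbd : ∀ t ∈ Icc t₀ b, ∀ z, f t z ≤ exp (K * (1 + ‖z‖ ^ 2)))
    (hB : ∀ t ∈ Icc t₀ b, K + 1 ≤ B t) :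
    ∃ a ∈ Ioo t₀ b, ∀ p, 0 < comparisonGap f k t₀ ε B a p := by
  have hT : 0 < T := by linarith
  have hsub : Icc t₀ b ⊆ Ioo 0 T := fun t ht => ⟨ht₀.trans_le ht.1, ht.2.trans_lt hb⟩
  obtain ⟨c, hc, hform⟩ := exists_harnackForm_le (n := n) hk hT
  set A := 4 * exp (2 * K / ε) / ε / c with hA
  have hApos : 0 < A := by positivity
  set S : Set (ℝ × (E n × E n)) := Icc t₀ b ×ˢ closedBall 0 (2 / ε + 1)
  have huc : UniformContinuousOn (fun q : ℝ × (E n × E n) => f q.1 q.2) S :=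
    (isCompact_Icc.prod (isCompact_closedBall _ _)).uniformContinuousOn_of_continuous
      (hf.continuousOn.mono (prod_mono hsub (subset_univ _)))
  obtain ⟨δ, hδ, hδf⟩ := Metric.uniformContinuousOn_iff.1 huc (ε / 4) (by positivity)
  set η := min (δ / 2) 1 with hη
  have hηpos : 0 < η := lt_min (by positivity) one_pos
  set s := min ((b - t₀) / 2) (η ^ 2 / A) with hs
  have hspos : 0 < s := lt_min (by linarith) (by positivity)
  have hsb : s ≤ (b - t₀) / 2 := min_le_left _ _
  have ha : t₀ + s ∈ Icc t₀ b := ⟨by linarith, by linarith⟩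
  refine ⟨t₀ + s, ⟨by linarith, by linarith⟩, ?_⟩
  rintro ⟨z, ζ, l⟩
  by_contra! hgap
  have hfm := hform (t₀ + s - t₀) ⟨by linarith, by linarith⟩ ζ
  have hq : harnackForm k (t₀ + s - t₀) ζ ≤ 0 := by
    refine hfm.trans (neg_nonpos.2 ?_)
    rw [add_sub_cancel_left]
    positivity
  obtain ⟨h1, h2, -, -⟩ := comparisonGap_nonpos_bounds hK hε (hpos _ (hsub ha)) (hbd _ ha)
    (hB _ ha) hq hgap
  have hζ2 := norm_sq_le_of_harnackForm hc (by linarith) hfm h2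
  have hζ : ‖ζ‖ ≤ η := by
    refine pow_le_pow_iff_left₀ (norm_nonneg ζ) hηpos.le two_ne_zero |>.1 (hζ2.trans ?_)
    rw [add_sub_cancel_left, ← hA, ← le_div_iff₀ hApos]
    exact min_le_right _ _
  have hζ1 : ‖ζ‖ ≤ 1 := hζ.trans (min_le_right _ _)
  have hζδ : ‖ζ‖ < δ := (hζ.trans (min_le_left _ _)).trans_lt (by linarith)
  have hz : ‖z‖ ≤ 2 / ε := by nlinarith [sq_nonneg (‖z‖ - 1)]
  have hnear : ∀ y : E n × E n, ‖y‖ = ‖ζ‖ → f (t₀ + s) z - ε / 4 ≤ f (t₀ + s) (z + y) := by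
    intro y hy
    have h3 := hδf (t₀ + s, z + y) ⟨ha, mem_closedBall_zero_iff.2 (by
        linarith [norm_add_le z y])⟩ (t₀ + s, z)
      ⟨ha, mem_closedBall_zero_iff.2 (by linarith)⟩ (by simpa [Prod.dist_eq, hy] using hζδ)
    rw [Real.dist_eq] at h3
    linarith [(abs_lt.1 h3).1]
  have hp := hnear ζ rfl
  have hm := hnear (-ζ) (norm_neg ζ)
  rw [← sub_eq_add_neg] at hm
  simp only [comparisonGap] at hgap
  have he1 : f (t₀ + s) z * exp (harnackForm k (t₀ + s - t₀) ζ / 2) ≤ f (t₀ + s) z :=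
    mul_le_of_le_one_right (hpos _ (hsub ha) z).le (exp_le_one_iff.2 (by linarith))
  have hbar : ε ≤ ε * barrier (B (t₀ + s)) z :=
    le_mul_of_one_le_right hε.le (one_le_exp (mul_nonneg (by linarith [hB _ ha]) (by positivity)))
  have hp' := mul_pos (exp_pos l) (hpos _ (hsub ha) (z + ζ))
  have hm' := mul_pos (exp_pos (-l)) (hpos _ (hsub ha) (z - ζ))
  rcases le_total (f (t₀ + s) z - ε / 4) 0 with h4 | h4
  · linarith
  · have h5 := mul_le_mul_of_nonneg_left hp (exp_pos l).le
    have h6 := mul_le_mul_of_nonneg_left hm (exp_pos (-l)).le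
    have h7 := mul_le_mul_of_nonneg_right (add_le_add (add_one_le_exp l) (add_one_le_exp (-l))) h4
    linarith

theorem twoPointHarnack_step
    (hf : ContDiffOn ℝ (⊤ : ℕ∞) (fun q : ℝ × (E n × E n) => f q.1 q.2) (Ioo 0 T ×ˢ univ))
    (hpos : ∀ t ∈ Ioo 0 T, ∀ z, 0 < f t z)
    (hpde : ∀ t ∈ Ioo 0 T, ∀ z, deriv (fun τ => f τ z) t =
      lapV (f t) z - fderiv ℝ (f t) z (z.2, 0) + h z * f t z)
    (hk : 0 < k) (hh : ∀ z ζ, h z + fderiv ℝ h z ζ - k * ‖ζ.2‖ ^ 2 / 2 ≤ h (z + ζ))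
    {a b K C : ℝ} (hb : b < T) (ht₀ : 0 < t₀) (hat : t₀ ≤ a)
    (hK : 0 ≤ K) (hC : 0 ≤ C) (hup : ∀ z, h z ≤ C * (1 + ‖z‖ ^ 2))
    (hbd : ∀ t ∈ Icc a b, ∀ z, f t z ≤ exp (K * (1 + ‖z‖ ^ 2)))
    (hab : a < b) (hstep : (b - a) * (2 * (2 * n + 6 + C) * (K + 1)) ≤ 1)
    (h0 : t₀ < a → TwoPointHarnack f k t₀ a) : TwoPointHarnack f k t₀ b := by
  set L := 2 * n + 6 + C with hL
  have hLpos : 0 < L := by positivity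
  set B : ℝ → ℝ := fun t => (K + 1) / (1 - L * (K + 1) * (t - a)) with hBdef
  have hden : ∀ t ∈ Icc a b, 1 - L * (K + 1) * (t - a) ∈ Ioc (0 : ℝ) 1 := by
    intro t ht
    have h1 : L * (K + 1) * (t - a) ≤ L * (K + 1) * (b - a) :=
      mul_le_mul_of_nonneg_left (by linarith [ht.2]) (by positivity)
    have h2 : 0 ≤ L * (K + 1) * (t - a) := mul_nonneg (by positivity) (by linarith [ht.1])
    exact ⟨by linarith, by linarith⟩
  have hB : ∀ t ∈ Icc a b, K + 1 ≤ B t := fun t ht =>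
    le_div_self (by linarith) (hden t ht).1 (hden t ht).2
  have hB' : ∀ t ∈ Icc a b, HasDerivAt B (L * B t ^ 2) t := by
    intro t ht
    have hne := (hden t ht).1.ne'
    refine ((hasDerivAt_const t (K + 1)).div
      ((((hasDerivAt_id t).sub_const a).const_mul (L * (K + 1))).const_sub 1) hne).congr_deriv ?_
    simp only [hBdef, id]
    field_simp
    ring
  intro z ζ l
  have hlim : ∀ ε > 0, 2 * f b z * exp (harnackForm k (b - t₀) ζ / 2) ≤
      exp l * f b (z + ζ) + exp (-l) * f b (z - ζ) + ε * barrier (B b) z := by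
    intro ε hε
    obtain ⟨a', ha', hpos'⟩ : ∃ a' ∈ Ico a b, t₀ < a' ∧ ∀ p, 0 < comparisonGap f k t₀ ε B a' p := by
      rcases hat.eq_or_lt with rfl | hlt
      · obtain ⟨a', ha', h1⟩ := exists_comparisonGap_pos_near hf hpos hk hb ht₀ hab hK hε hbd hB
        exact ⟨a', ⟨ha'.1.le, ha'.2⟩, ha'.1, h1⟩
      · refine ⟨a, ⟨le_rfl, hab⟩, hlt, fun p => ?_⟩
        have h1 := h0 hlt p.1 p.2.1 p.2.2
        have h2 := mul_pos hε (barrier_pos (B a) p.1)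
        rw [comparisonGap]
        linarith
    have hss : Icc a' b ⊆ Icc a b := Icc_subset_Icc_left ha'.1
    have h1 := comparisonGap_pos_of_pos hf hpos hpde hk hh hb ht₀ hpos'.1 hK hC hε hup
      (fun t ht => hbd t (hss ht)) (fun t ht => hB t (hss ht)) (fun t ht => hB' t (hss ht))
      hpos'.2 b ⟨ha'.2.le, le_rfl⟩ (z, ζ, l)
    simp only [comparisonGap] at h1
    linarith
  refine le_of_forall_pos_le_add fun δ hδ => ?_
  have h1 := hlim (δ / barrier (B b) z) (div_pos hδ (barrier_pos _ _))
  rwa [div_mul_cancel₀ _ (barrier_pos _ _).ne'] at h1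

theorem twoPointHarnack
    (hf : ContDiffOn ℝ (⊤ : ℕ∞) (fun q : ℝ × (E n × E n) => f q.1 q.2) (Ioo 0 T ×ˢ univ))
    (hpos : ∀ t ∈ Ioo 0 T, ∀ z, 0 < f t z)
    (hpde : ∀ t ∈ Ioo 0 T, ∀ z, deriv (fun τ => f τ z) t =
      lapV (f t) z - fderiv ℝ (f t) z (z.2, 0) + h z * f t z)
    (hk : 0 < k) (hh : ∀ z ζ, h z + fderiv ℝ h z ζ - k * ‖ζ.2‖ ^ 2 / 2 ≤ h (z + ζ))
    {t K C : ℝ} (ht : t < T) (ht₀ : 0 < t₀) (htt : t₀ < t)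
    (hK : 0 ≤ K) (hC : 0 ≤ C) (hup : ∀ z, h z ≤ C * (1 + ‖z‖ ^ 2))
    (hbd : ∀ s ∈ Icc t₀ t, ∀ z, f s z ≤ exp (K * (1 + ‖z‖ ^ 2))) :
    TwoPointHarnack f k t₀ t := by
  set D := 2 * (2 * n + 6 + C) * (K + 1) with hD
  have hDpos : 0 < D := by positivity
  have hind : ∀ m : ℕ, ∀ b ∈ Ioc t₀ t, b ≤ t₀ + m / D → TwoPointHarnack f k t₀ b := by
    intro m
    induction m with
    | zero =>
      intro b hb hbm
      simp only [Nat.cast_zero, zero_div, add_zero] at hbm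
      exact absurd hb.1 hbm.not_gt
    | succ m ih =>
      intro b hb hbm
      push_cast at hbm
      rw [add_div] at hbm
      have hD1 : 0 < 1 / D := by positivity
      refine twoPointHarnack_step (a := max t₀ (b - 1 / D)) hf hpos hpde hk hh
        (hb.2.trans_lt ht) ht₀ (le_max_left _ _) hK hC hup
        (fun s hs => hbd s ⟨(le_max_left _ _).trans hs.1, hs.2.trans hb.2⟩)
        (max_lt hb.1 (by linarith)) ?_ fun hlt => ?_
      · rw [← hD, ← le_div_iff₀ hDpos]
        linarith [le_max_right t₀ (b - 1 / D)]
      · have h1 : max t₀ (b - 1 / D) = b - 1 / D :=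
          max_eq_right ((lt_max_iff.1 hlt).resolve_left (lt_irrefl _)).le
        rw [h1] at hlt ⊢
        exact ih _ ⟨hlt, by linarith [hb.2]⟩ (by linarith)
  obtain ⟨m, hm⟩ := exists_nat_ge ((t - t₀) * D)
  refine hind m t ⟨htt, le_rfl⟩ ?_
  rw [← le_div_iff₀ hDpos] at hm
  linarith

end TwoPoint

section LogHessian
open Filter Topology

variable {n : ℕ}

theorem dirDeriv2_add {g₁ g₂ : E n × E n → ℝ} (h₁ : ContDiff ℝ (⊤ : ℕ∞) g₁)
    (h₂ : ContDiff ℝ (⊤ : ℕ∞) g₂) (ζ z : E n × E n) :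
    dirDeriv2 (fun y => g₁ y + g₂ y) ζ z = dirDeriv2 g₁ ζ z + dirDeriv2 g₂ ζ z := by
  have h : (fun y => fderiv ℝ (fun y => g₁ y + g₂ y) y ζ) =
      fun y => fderiv ℝ g₁ y ζ + fderiv ℝ g₂ y ζ := by
    ext y
    rw [fderiv_fun_add (differentiable_of_smooth h₁ y) (differentiable_of_smooth h₂ y),
      _root_.add_apply]
  rw [dirDeriv2, h, fderiv_fun_add
    (differentiable_of_smooth (contDiff_fderiv_apply h₁ ζ) z)
    (differentiable_of_smooth (contDiff_fderiv_apply h₂ ζ) z), _root_.add_apply]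
  rfl

theorem dirDeriv2_neg_dir (g : E n × E n → ℝ) (ζ z : E n × E n) :
    dirDeriv2 g (-ζ) z = dirDeriv2 g ζ z := by
  simp [dirDeriv2]

theorem le_dirDeriv2_log {g : E n × E n → ℝ} (hg : ContDiff ℝ (⊤ : ℕ∞) g) (hpos : ∀ z, 0 < g z)
    {q : ℝ} {z ζ : E n × E n} (hq : ∀ s l : ℝ, 2 * g z * exp (s ^ 2 * q / 2) ≤
      exp l * g (z + s • ζ) + exp (-l) * g (z - s • ζ)) :
    q ≤ dirDeriv2 (fun y => log (g y)) ζ z := by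
  have hlog : ContDiff ℝ (⊤ : ℕ∞) fun y => log (g y) := hg.log fun y => (hpos y).ne'
  have hmid : ∀ s : ℝ, 2 * log (g z) ≤
      log (g (z + s • ζ)) + log (g (z + s • -ζ)) - q * s ^ 2 := by
    intro s
    rw [smul_neg, ← sub_eq_add_neg]
    have h1 := hq s ((log (g (z - s • ζ)) - log (g (z + s • ζ))) / 2)
    rw [← exp_log (hpos z), ← exp_log (hpos (z + s • ζ)), ← exp_log (hpos (z - s • ζ)), log_exp,
      log_exp, mul_assoc, ← exp_add, ← exp_add, ← exp_add] at h1
    set m := (log (g (z + s • ζ)) + log (g (z - s • ζ))) / 2 with hm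
    rw [show (log (g (z - s • ζ)) - log (g (z + s • ζ))) / 2 + log (g (z + s • ζ)) = m by
        rw [hm]; ring,
      show -((log (g (z - s • ζ)) - log (g (z + s • ζ))) / 2) + log (g (z - s • ζ)) = m by
        rw [hm]; ring, ← two_mul] at h1
    have h2 := exp_le_exp.1 (le_of_mul_le_mul_left h1 two_pos)
    linarith
  have hmin : IsLocalMin (fun s : ℝ => log (g (z + s • ζ)) + log (g (z + s • -ζ)) - q * s ^ 2) 0 :=
    Eventually.of_forall fun s => by
      simpa [two_mul] using hmid s
  have hd := differentiable_of_smooth hlog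
  have h := second_deriv_nonneg_of_isLocalMin hmin
    (Eventually.of_forall fun s => ((hasDerivAt_line hd z ζ s).add
      (hasDerivAt_line hd z (-ζ) s)).sub ((hasDerivAt_pow 2 s).const_mul q))
    (((hasDerivAt_line2 hlog z ζ 0).add (hasDerivAt_line2 hlog z (-ζ) 0)).sub
      (((hasDerivAt_id (0 : ℝ)).const_mul 2).const_mul q |>.congr_of_eventuallyEq
        (Eventually.of_forall fun s => by simp)))
  rw [zero_smul, zero_smul, add_zero, dirDeriv2_neg_dir] at h
  linarith

theorem continuousAt_harnackForm {k t : ℝ} (hk : 0 < k) (ht : 0 < t) (ζ : E n × E n) :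
    ContinuousAt (fun s => harnackForm k s ζ) t :=
  (((hasDerivAt_harnackXX hk ht).continuousAt.mul continuousAt_const).add
    ((continuousAt_const.mul (hasDerivAt_harnackXV hk ht).continuousAt).mul continuousAt_const)).add
    ((hasDerivAt_harnackVV hk ht).continuousAt.mul continuousAt_const)

theorem coords_dotProduct_harnackMatrix (k t : ℝ) (ζ : E n × E n) :
    coords ζ ⬝ᵥ (harnackMatrix n (s0D k) (s1D k) (s2D k) t *ᵥ coords ζ) = harnackForm k t ζ := by
  rw [harnackMatrix, Matrix.smul_mulVec, dotProduct_smul, coords_dotProduct_blocks, harnackForm,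
    harnackXX, harnackXV, harnackVV, smul_eq_mul]
  ring

theorem harnackMatrix_isHermitian (k t : ℝ) :
    (harnackMatrix n (s0D k) (s1D k) (s2D k) t).IsHermitian := by
  simp [harnackMatrix, Matrix.IsHermitian, Matrix.fromBlocks_transpose]

theorem posSemidef_of_harnackForm_le {g U : E n × E n → ℝ} (hg : ContDiff ℝ (⊤ : ℕ∞) g)
    (hU : ContDiff ℝ (⊤ : ℕ∞) U) {k t : ℝ} {z : E n × E n}
    (h : ∀ ζ, harnackForm k t ζ ≤ dirDeriv2 g ζ z - dirDeriv2 U ζ z / 2) :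
    (Hess g z - (1 / 2 : ℝ) • Hess U z
      - harnackMatrix n (s0D k) (s1D k) (s2D k) t).PosSemidef := by
  refine .of_dotProduct_mulVec_nonneg (((hess_isHermitian hg z).sub ?_).sub
    (harnackMatrix_isHermitian k t)) fun c => ?_
  · rw [Matrix.IsHermitian, Matrix.conjTranspose_smul, hess_isHermitian hU z, star_trivial]
  · obtain ⟨ζ, rfl⟩ : ∃ ζ : E n × E n, c = coords ζ :=
      ⟨(WithLp.toLp 2 (c ∘ Sum.inl), WithLp.toLp 2 (c ∘ Sum.inr)), by
        ext j
        cases j <;> rfl⟩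
    rw [star_trivial, Matrix.sub_mulVec, Matrix.sub_mulVec, Matrix.smul_mulVec, dotProduct_sub,
      dotProduct_sub, dotProduct_smul, coords_dotProduct_hess hg, coords_dotProduct_hess hU,
      coords_dotProduct_harnackMatrix, smul_eq_mul]
    linarith [h ζ]

end LogHessian

section Conjugation

variable {n : ℕ} {T : ℝ} {U : E n × E n → ℝ} {ρ : ℝ → E n × E n → ℝ}

theorem contDiffOn_conjugate (hU : ContDiff ℝ (⊤ : ℕ∞) U)
    (hρ : ContDiffOn ℝ (⊤ : ℕ∞) (fun q : ℝ × (E n × E n) => ρ q.1 q.2) (Ioo 0 T ×ˢ univ)) :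
    ContDiffOn ℝ (⊤ : ℕ∞) (fun q : ℝ × (E n × E n) => exp (-U q.2 / 2) * ρ q.1 q.2)
      (Ioo 0 T ×ˢ univ) :=
  ((((hU.comp contDiff_snd).neg).div_const 2).exp.contDiffOn).mul hρ

theorem deriv_conjugate (hU : ContDiff ℝ (⊤ : ℕ∞) U)
    (hρ : ContDiffOn ℝ (⊤ : ℕ∞) (fun q : ℝ × (E n × E n) => ρ q.1 q.2) (Ioo 0 T ×ˢ univ))
    (hpde : ∀ t ∈ Ioo 0 T, ∀ p : E n × E n,
      deriv (fun τ => ρ τ p) t =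
        lapV (ρ t) p - (∑ i : Fin n, pd U (Sum.inr i) p * pd (ρ t) (Sum.inr i) p)
          - ∑ i : Fin n, p.2 i * pd (ρ t) (Sum.inl i) p)
    {t : ℝ} (ht : t ∈ Ioo 0 T) (z : E n × E n) :
    deriv (fun τ => exp (-U z / 2) * ρ τ z) t =
      lapV (fun z => exp (-U z / 2) * ρ t z) z -
        fderiv ℝ (fun z => exp (-U z / 2) * ρ t z) z (z.2, 0) +
        hfun U z * (exp (-U z / 2) * ρ t z) := by
  rw [exp_neg_half_mul_generator hU (contDiff_slice hρ ht), ← hpde t ht,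
    deriv_const_mul _ (hasDerivAt_curve hρ ht (hasDerivAt_const t z)).differentiableAt]

theorem dirDeriv2_log_conjugate (hU : ContDiff ℝ (⊤ : ℕ∞) U) {g : E n × E n → ℝ}
    (hg : ContDiff ℝ (⊤ : ℕ∞) g) (hpos : ∀ z, 0 < g z) (ζ z : E n × E n) :
    dirDeriv2 (fun y => log (exp (-U y / 2) * g y)) ζ z =
      dirDeriv2 (fun y => log (g y)) ζ z - dirDeriv2 U ζ z / 2 := by
  have h : (fun y => log (exp (-U y / 2) * g y)) = fun y => -U y / 2 + log (g y) := by
    ext y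
    rw [log_mul (exp_pos _).ne' (hpos y).ne', log_exp]
  rw [h, dirDeriv2_add (hU.neg.div_const 2) (hg.log fun y => (hpos y).ne'), dirDeriv2_neg_half hU]
  ring

end Conjugation

/-- **Matrix differential Harnack inequality, case `k₂² > 2k₁ = 0`** (Theorem 2.1 (4)). -/
theorem matrix_harnack_case4
    (n : ℕ) (hn : 1 ≤ n) (T : ℝ) (hT : 0 < T)
    (U : E n × E n → ℝ) (hU : ContDiff ℝ (⊤ : ℕ∞) U)
    (ρ : ℝ → E n × E n → ℝ)
    (hρ : ContDiffOn ℝ (⊤ : ℕ∞) (fun q : ℝ × (E n × E n) => ρ q.1 q.2) (Ioo 0 T ×ˢ univ))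
    (hpos : ∀ t ∈ Ioo 0 T, ∀ p : E n × E n, 0 < ρ t p)
    (hpde : ∀ t ∈ Ioo 0 T, ∀ p : E n × E n,
      deriv (fun τ => ρ τ p) t =
        lapV (ρ t) p - (∑ i : Fin n, pd U (Sum.inr i) p * pd (ρ t) (Sum.inr i) p)
          - ∑ i : Fin n, p.2 i * pd (ρ t) (Sum.inl i) p)
    (a₀ a₁ : ℝ) (ha₀ : 0 < a₀) (ha₁ : 0 < a₁)
    (hgrow1 : ∀ t ∈ Ioo 0 T, ∀ p : E n × E n,
      Real.sqrt (gradNormSq (ρ t) p) ≤ a₀ * Real.exp (-U p / 2) * (‖p.1‖ + ‖p.2‖))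
    (hgrow2 : ∀ t ∈ Ioo 0 T, ∀ p : E n × E n,
      (Hess (ρ t) p + (a₀ * Real.exp (a₁ * (‖p.1‖ ^ 2 + ‖p.2‖ ^ 2))) •
        (1 : Matrix (Fin n ⊕ Fin n) (Fin n ⊕ Fin n) ℝ)).PosSemidef)
    (hgrow3 : ∀ p : E n × E n,
      ((a₀ * Real.exp (a₁ * (‖p.1‖ ^ 2 + ‖p.2‖ ^ 2))) •
        (1 : Matrix (Fin n ⊕ Fin n) (Fin n ⊕ Fin n) ℝ) - Hess U p).PosSemidef)
    (k₂ : ℝ) (hk₂ : 0 < k₂)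
    (hh : ∀ p : E n × E n, (Hess (hfun U) p - blockDiag n 0 (-k₂)).PosSemidef) :
    ∀ t ∈ Ioo 0 T, ∀ p : E n × E n,
      (Hess (fun q => Real.log (ρ t q)) p - (1/2 : ℝ) • Hess U p
        - harnackMatrix n (s0D k₂) (s1D k₂) (s2D k₂) t).PosSemidef := by
  have hw : ContDiff ℝ (⊤ : ℕ∞) fun z => -U z / 2 := hU.neg.div_const 2
  have hh_smooth := contDiff_hfun hU
  have hconv : ∀ z ζ, -(k₂ * ‖ζ.2‖ ^ 2) ≤ dirDeriv2 (hfun U) ζ z := fun z ζ =>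
    le_dirDeriv2_of_posSemidef hh_smooth (hh z) ζ
  have hst := exp_neg_half_stationary hU
  have hw2 : ∀ z ζ : E n × E n,
      -(a₀ * exp (a₁ * (‖z.1‖ ^ 2 + ‖z.2‖ ^ 2)) * (‖ζ.1‖ ^ 2 + ‖ζ.2‖ ^ 2)) ≤
        dirDeriv2 (fun z => -U z / 2) ζ z := by
    intro z ζ
    rw [dirDeriv2_neg_half hU]
    have h1 := dirDeriv2_le_of_posSemidef hU (hgrow3 z) ζ
    have h2 : 0 ≤ a₀ * exp (a₁ * (‖z.1‖ ^ 2 + ‖z.2‖ ^ 2)) * (‖ζ.1‖ ^ 2 + ‖ζ.2‖ ^ 2) := by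
      positivity
    linarith
  obtain ⟨C₀, hC₀, hlow⟩ := exists_quadratic_lower_bound hk₂.le hh_smooth hconv
  obtain ⟨J, hJ, hjoin⟩ := log_propagation_join hn hw hst hC₀ hlow
  obtain ⟨C₁, hC₁, hwlow⟩ := exists_log_lower_bound hw hJ hjoin
  obtain ⟨C₂, hC₂, hwup⟩ := exists_log_upper_bound hw hJ hjoin ha₀ ha₁ hw2
  obtain ⟨C, hC, hup⟩ :=
    exists_quadratic_upper_bound hn hw hst hk₂.le hh_smooth hconv hC₁ hC₂ hwlow hwup
  intro t ht z
  have hρt := contDiff_slice hρ ht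
  refine posSemidef_of_harnackForm_le (hρt.log fun y => (hpos t ht y).ne') hU fun ζ => ?_
  rw [← dirDeriv2_log_conjugate hU hρt (hpos t ht)]
  have hlim : Filter.Tendsto (fun t₀ => harnackForm k₂ (t - t₀) ζ) (nhdsWithin 0 (Ioi 0))
      (nhds (harnackForm k₂ t ζ)) := by
    refine Filter.Tendsto.mono_left ?_ nhdsWithin_le_nhds
    have h := continuousAt_harnackForm hk₂ ht.1 ζ
    rw [← sub_zero t] at h
    simpa [Function.comp_def] using ContinuousAt.tendsto
      (h.comp (f := fun t₀ => t - t₀) (by fun_prop))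
  refine le_of_tendsto hlim ?_
  filter_upwards [Ioo_mem_nhdsGT ht.1] with t₀ ht₀
  obtain ⟨K, hK, hbd⟩ :=
    exists_solution_bound (w := fun z => -U z / 2) hρ ha₀ hgrow1 hC₂ hwup ht₀.1 ht.2
  have htwo := twoPointHarnack (f := fun t z => exp (-U z / 2) * ρ t z) (contDiffOn_conjugate hU hρ)
    (fun s hs y => mul_pos (exp_pos _) (hpos s hs y))
    (fun s hs y => deriv_conjugate hU hρ hpde hs y)
    hk₂ (hfun_taylor hh_smooth hconv) ht.2 ht₀.1 ht₀.2 hK hC hup hbd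
  refine le_dirDeriv2_log (hw.exp.mul hρt) (fun y => mul_pos (exp_pos _) (hpos t ht y))
    fun s l => ?_
  rw [← harnackForm_smul]
  exact htwo z (s • ζ) l
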